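/- arXiv:1810.07586 — 2 statements merged into one kernel-verified Lean document; each statement's English description precedes it below -/
import Mathlib

section
/- For all integers i ≥ 1 and j ≥ 1, the sequence of real numbers n ↦ (number of minimal factorizations F ∈ 𝔐_n with T_1(F) = i and M_1(F) = j) / n^{n-2} converges, as n → ∞, to e^{-2} / ((i-1)! (j-1)!). In particular, the pair (T_1, M_1) under the uniform distribution on 𝔐_n converges in distribution to a pair of two independent random variables each distributed as 1 plus a Poisson(1) random variable. -/
/-- `F` is a minimal factorization of size `n`, i.e. a factorization of the cycle
`(1,2,…,n)` (represented as `finRotate n` on `Fin n`, where the element `i ∈ {1,…,n}`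
corresponds to the index `i-1 : Fin n`) into `n-1` transpositions: each `F k` is a
transposition and the left-to-right product `τ₁ τ₂ ⋯ τ_{n-1}` (apply `τ₁` first)
equals the cycle. -/
def IsMinFact (n : ℕ) (F : Fin (n - 1) → Equiv.Perm (Fin n)) : Prop :=
  (∀ k, (F k).IsSwap) ∧ (List.ofFn F).reverse.prod = finRotate n

/-- `T(F, x)`: the number of transpositions in `F` moving the element represented by `x`. -/
def Tcount {n : ℕ} (F : Fin (n - 1) → Equiv.Perm (Fin n)) (x : Fin n) : ℕ :=
  (Finset.univ.filter fun k : Fin (n - 1) => F k x ≠ x).card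

/-- `M(F, x)`: the number of indices `1 ≤ k ≤ n-1` with `τ₁⋯τ_{k-1}(x) ≠ τ₁⋯τ_k(x)`,
i.e. the number of transpositions affecting the trajectory of `x` (left-to-right
partial products, so `τ₁⋯τ_k` is the product of the first `k` entries, applied
`τ₁` first). -/
def Mcount {n : ℕ} (F : Fin (n - 1) → Equiv.Perm (Fin n)) (x : Fin n) : ℕ :=
  (Finset.univ.filter fun k : Fin (n - 1) =>
    ((List.ofFn F).take k.val).reverse.prod x ≠
      ((List.ofFn F).take (k.val + 1)).reverse.prod x).card

section

open Polynomial Finset Equiv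

section AbelConvolution

variable {R : Type*} [CommRing R] [Algebra ℚ R]

/-- The Abel polynomials `X (X + k)^(k-1) / k!`. -/
noncomputable def abelPoly (R : Type*) [CommRing R] [Algebra ℚ R] : ℕ → R[X]
  | 0 => 1
  | k + 1 => ((k + 1).factorial : ℚ)⁻¹ • (X * (X + (k + 1 : R[X])) ^ k)

/-- The shifted monomials `(X + k)^k / k!`. -/
noncomputable def shiftedMonomial (R : Type*) [CommRing R] [Algebra ℚ R] (k : ℕ) : R[X] :=
  ((k.factorial : ℚ)⁻¹) • (X + (k : R[X])) ^ k

lemma inv_factorial_succ (k : ℕ) :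
    ((k.factorial : ℚ)⁻¹) = ((k + 1).factorial : ℚ)⁻¹ * ((k + 1 : ℕ) : ℚ) := by
  rw [Nat.factorial_succ]
  push_cast
  have : (k : ℚ) + 1 ≠ 0 := by positivity
  field_simp

lemma derivative_shiftedMonomial_succ (k : ℕ) :
    derivative (shiftedMonomial R (k + 1)) = (shiftedMonomial R k).comp (X + 1) := by
  simp only [shiftedMonomial, derivative_smul, inv_factorial_succ k, mul_smul, smul_comp]
  congr 1
  simp only [Nat.cast_smul_eq_nsmul, nsmul_eq_mul]
  simp [derivative_pow]
  ring

lemma derivative_abelPoly_succ (k : ℕ) :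
    derivative (abelPoly R (k + 1)) = (abelPoly R k).comp (X + 1) := by
  rcases k with _ | k
  · simp [abelPoly]
  · simp only [abelPoly, derivative_smul, inv_factorial_succ (k + 1), mul_smul, smul_comp]
    congr 1
    simp only [Nat.cast_smul_eq_nsmul, nsmul_eq_mul]
    simp [derivative_pow]
    ring

lemma abelPoly_succ_eval_zero (k : ℕ) : (abelPoly R (k + 1)).eval 0 = 0 := by
  simp [abelPoly]

omit [Algebra ℚ R] in
lemma eq_of_derivative_eq_of_eval_zero_eq [IsDomain R] [CharZero R] {p q : R[X]}
    (hd : derivative p = derivative q) (h0 : p.eval 0 = q.eval 0) : p = q := by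
  rw [← sub_eq_zero, eq_C_of_derivative_eq_zero (p := p - q) (by rw [derivative_sub, hd, sub_self]),
    coeff_zero_eq_eval_zero, eval_sub, h0, sub_self, C_0]

/-- Abel's binomial theorem, for every sequence `f` with `f (k + 1)' = f k (X + 1)`. -/
theorem sum_eval_mul_abelPoly [IsDomain R] [CharZero R] (f : ℕ → R[X]) (h0 : derivative (f 0) = 0)
    (hf : ∀ k, derivative (f (k + 1)) = (f k).comp (X + 1)) (x : R) (n : ℕ) :
    ∑ p ∈ antidiagonal n, C ((f p.1).eval x) * abelPoly R p.2 = (f n).comp (C x + X) := by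
  induction n with
  | zero =>
    obtain ⟨c, hc⟩ : ∃ c, f 0 = C c := ⟨_, eq_C_of_derivative_eq_zero h0⟩
    simp [abelPoly, hc]
  | succ n ih =>
    rw [Finset.Nat.sum_antidiagonal_succ']
    refine eq_of_derivative_eq_of_eval_zero_eq ?_ ?_
    · rw [derivative_add, derivative_sum, derivative_comp, hf]
      simp only [derivative_mul, derivative_C, zero_mul, zero_add, derivative_abelPoly_succ]
      have := congrArg (fun p => p.comp (X + 1)) ih
      simp only [Polynomial.sum_comp, mul_comp, C_comp] at this
      rw [this]
      simp [abelPoly, comp_assoc, add_assoc]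
    · simp [eval_finsetSum, abelPoly]

/-- The weight `x y (x + y + k - 1)^(k-1) / k!` of a cycle of length `k + 1`. -/
noncomputable def cycleWeight : ℕ → R → R → R
  | 0, _, _ => 1
  | k + 1, x, y => ((k + 1).factorial : ℚ)⁻¹ • (x * y * (x + y + k) ^ k)

lemma cycleWeight_one_right (k : ℕ) (x : R) :
    cycleWeight k x 1 = (abelPoly R k).eval x := by
  rcases k with _ | k
  · simp [cycleWeight, abelPoly]
  · simp [cycleWeight, abelPoly, eval_smul]
    ring_nf

lemma cycleWeight_comm (k : ℕ) (x y : R) : cycleWeight k x y = cycleWeight k y x := by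
  rcases k with _ | k
  · rfl
  · simp only [cycleWeight]
    ring_nf

lemma cycleWeight_one_left (k : ℕ) (x : R) :
    cycleWeight k 1 x = (abelPoly R k).eval x := by
  rw [cycleWeight_comm, cycleWeight_one_right]

lemma succ_mul_cycleWeight (k : ℕ) (x y : R) :
    ((k + 1 : ℕ) : R) * cycleWeight (k + 1) x y =
      x * y * (shiftedMonomial R k).eval (x + y) := by
  simp only [cycleWeight, shiftedMonomial, eval_smul, inv_factorial_succ k, mul_smul,
    Nat.cast_smul_eq_nsmul, nsmul_eq_mul]
  simp only [mul_smul_comm, eval_mul, eval_pow, eval_add, eval_X, eval_natCast]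
  ring_nf

lemma sum_range_eval_abelPoly [IsDomain R] [CharZero R] (f : ℕ → R[X])
    (h0 : derivative (f 0) = 0) (hf : ∀ k, derivative (f (k + 1)) = (f k).comp (X + 1))
    (x y : R) (n : ℕ) :
    ∑ i ∈ range (n + 1), (f (n - i)).eval x * (abelPoly R i).eval y = (f n).eval (x + y) := by
  have h := congrArg (eval y) (sum_eval_mul_abelPoly f h0 hf x n)
  rw [Finset.Nat.sum_antidiagonal_eq_sum_range_succ_mk, ← Finset.sum_range_reflect,
    eval_finsetSum] at h
  simp only [eval_mul, eval_C, eval_comp, eval_add, eval_X] at h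
  rw [← h]
  refine Finset.sum_congr rfl fun i hi => ?_
  have : i ≤ n := by simpa [Nat.lt_succ_iff] using hi
  congr 3
  rw [Nat.succ_eq_add_one]
  omega

/-- The sum of the weights of all ways of splitting a cycle of length `n + 1` in two. -/
theorem sum_cycleWeight [IsDomain R] [CharZero R] (n : ℕ) (x y : R) :
    ∑ i ∈ range n, x * y * (cycleWeight (n - 1 - i) x 1 * cycleWeight i 1 y) +
      ∑ i ∈ range n, ((n - 1 - i : ℕ) : R) *
        (cycleWeight (n - 1 - i) x y * cycleWeight i 1 1) =
      n * cycleWeight n x y := by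
  rcases n with _ | n
  · simp
  rw [← Finset.mul_sum]
  simp only [Nat.add_sub_cancel]
  rw [succ_mul_cycleWeight]
  have e1 := sum_range_eval_abelPoly (abelPoly R) (by simp [abelPoly])
    derivative_abelPoly_succ x y n
  simp only [cycleWeight_one_right, cycleWeight_one_left, e1]
  rcases n with _ | n
  · simp [abelPoly, shiftedMonomial]
  have e2 := sum_range_eval_abelPoly (shiftedMonomial R) (by simp [shiftedMonomial])
    derivative_shiftedMonomial_succ (x + y) 1 n
  have e3 : ∀ i ∈ range (n + 1), ((n + 1 - i : ℕ) : R) *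
      (cycleWeight (n + 1 - i) x y * (abelPoly R i).eval 1) =
      x * y * ((shiftedMonomial R (n - i)).eval (x + y) * (abelPoly R i).eval 1) := by
    intro i hi
    have : n + 1 - i = n - i + 1 := by
      have := Finset.mem_range.1 hi
      omega
    rw [this, ← mul_assoc, succ_mul_cycleWeight, mul_assoc]
  rw [Finset.sum_range_succ _ (n + 1), Finset.sum_congr rfl e3, ← Finset.mul_sum, e2]
  simp only [abelPoly, shiftedMonomial, eval_smul, inv_factorial_succ n, mul_smul,
    Nat.cast_smul_eq_nsmul, nsmul_eq_mul]
  simp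
  rw [← smul_add]
  ring_nf

end AbelConvolution

section CycleDecomposition

variable {α : Type*} [DecidableEq α]

namespace List

lemma formPerm_append_cons (l₁ : List α) (b : α) (l₂ : List α) :
    (l₁ ++ b :: l₂).formPerm = (l₁ ++ [b]).formPerm * (b :: l₂).formPerm := by
  induction l₁ with
  | nil => simp
  | cons a l₁ ih =>
    rcases l₁ with _ | ⟨c, l₁⟩
    · simp [formPerm_cons_cons]
    · simp only [cons_append, formPerm_cons_cons] at ih ⊢
      rw [ih, mul_assoc]

lemma formPerm_mul_swap {a b : α} {l₁ l₂ : List α} (h : (a :: l₁ ++ b :: l₂).Nodup) :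
    (a :: l₁ ++ b :: l₂).formPerm * Equiv.swap a b =
      (b :: l₁).formPerm * (a :: l₂).formPerm := by
  have h₀ : (a :: (l₁ ++ b :: l₂)) ~r (l₁ ++ b :: (l₂ ++ [a])) :=
    ⟨1, by simp⟩
  have h₁ : (b :: (l₂ ++ [a])) ~r (l₂ ++ [a, b]) := ⟨1, by simp⟩
  have h₂ : (b :: l₁) ~r (l₁ ++ [b]) := ⟨1, by simp⟩
  have h₃ : (a :: l₂) ~r (l₂ ++ [a]) := ⟨1, by simp⟩
  have hn : (l₁ ++ b :: (l₂ ++ [a])).Nodup := h₀.nodup_iff.1 (by simpa using h)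
  have hb : (b :: (l₂ ++ [a])).Nodup := hn.of_append_right
  have hb₁ : (b :: l₁).Nodup := by grind
  have hb₂ : (a :: l₂).Nodup := by grind
  rw [cons_append, formPerm_eq_of_isRotated (by simpa using h) h₀, formPerm_append_cons,
    formPerm_eq_of_isRotated hb h₁, formPerm_append_pair,
    formPerm_eq_of_isRotated hb₁ h₂, formPerm_eq_of_isRotated hb₂ h₃]
  simp [mul_assoc]

omit [DecidableEq α] in
lemma exists_isRotated_cons {l : List α} {a : α} (h : a ∈ l) : ∃ t, l ~r (a :: t) := by
  obtain ⟨s, t, rfl⟩ := append_of_mem h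
  exact ⟨t ++ s, ⟨s.length, by simp⟩⟩

end List

variable [Fintype α]

/-- `cs` lists the cycles of `σ`, fixed points included, each as a head and a tail. -/
structure IsCycleDecomposition (σ : Perm α) (cs : Multiset (α × List α)) : Prop where
  bind_eq : cs.bind (fun c => ((c.1 :: c.2 : List α) : Multiset α)) = univ.val
  apply_eq : ∀ c ∈ cs, ∀ a ∈ c.1 :: c.2, σ a = (c.1 :: c.2).formPerm a

/-- The number of points minus the number of cycles. -/
def reflectionLength (cs : Multiset (α × List α)) : ℕ := (cs.map fun c => c.2.length).sum

namespace IsCycleDecomposition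

variable {σ : Perm α} {cs : Multiset (α × List α)} {c c₁ c₂ : α × List α} {a b : α}

lemma nodup_bind (h : IsCycleDecomposition σ cs) :
    (cs.bind (fun c => ((c.1 :: c.2 : List α) : Multiset α))).Nodup := by
  rw [h.bind_eq]
  exact univ.nodup

lemma nodup_cons (h : IsCycleDecomposition σ (c ::ₘ cs)) : (c.1 :: c.2).Nodup := by
  have := h.nodup_bind
  rw [Multiset.cons_bind, Multiset.nodup_add] at this
  exact this.1

lemma notMem_of_mem (h : IsCycleDecomposition σ (c ::ₘ cs)) (ha : a ∈ c.1 :: c.2)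
    (hc : c₁ ∈ cs) : a ∉ c₁.1 :: c₁.2 := by
  have := h.nodup_bind
  rw [Multiset.cons_bind, Multiset.nodup_add] at this
  exact fun ha' => Multiset.disjoint_left.1 this.2.2 ha (Multiset.mem_bind.2 ⟨c₁, hc, ha'⟩)

lemma exists_mem (h : IsCycleDecomposition σ cs) (a : α) : ∃ c ∈ cs, a ∈ c.1 :: c.2 := by
  have : a ∈ univ.val := mem_univ a
  rw [← h.bind_eq] at this
  simpa using this

lemma apply_eq_of_mem_rotated (h : IsCycleDecomposition σ (c ::ₘ cs)) {l : List α}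
    (hl : (c.1 :: c.2) ~r l) (ha : a ∈ l) : σ a = l.formPerm a := by
  rw [h.apply_eq c (Multiset.mem_cons_self _ _) a (hl.mem_iff.2 ha),
    List.formPerm_eq_of_isRotated h.nodup_cons hl]

lemma split (h : IsCycleDecomposition σ (c ::ₘ cs)) {l₁ l₂ : List α}
    (hc : (c.1 :: c.2) ~r (a :: l₁ ++ b :: l₂)) (hc₁ : (c₁.1 :: c₁.2) ~r (a :: l₂))
    (hc₂ : (c₂.1 :: c₂.2) ~r (b :: l₁)) :
    IsCycleDecomposition (σ * Equiv.swap a b) (c₁ ::ₘ c₂ ::ₘ cs) := by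
  have hn := hc.nodup_iff.1 h.nodup_cons
  have hn₁ : (a :: l₂).Nodup := by grind
  have hn₂ : (b :: l₁).Nodup := by grind
  have ha : a ∈ c.1 :: c.2 := hc.mem_iff.2 (by simp)
  have hb : b ∈ c.1 :: c.2 := hc.mem_iff.2 (by simp)
  have hσ : ∀ x ∈ a :: l₁ ++ b :: l₂,
      (σ * Equiv.swap a b) x = (b :: l₁).formPerm ((a :: l₂).formPerm x) := by
    intro x hx
    rw [← Perm.mul_apply, ← List.formPerm_mul_swap hn, Perm.mul_apply, Perm.mul_apply]
    refine h.apply_eq_of_mem_rotated hc ?_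
    rw [Equiv.swap_apply_def]
    split_ifs <;> simp_all
  refine ⟨?_, ?_⟩
  · rw [← h.bind_eq]
    simp only [Multiset.cons_bind]
    rw [Multiset.coe_eq_coe.2 hc₁.perm, Multiset.coe_eq_coe.2 hc₂.perm,
      Multiset.coe_eq_coe.2 hc.perm, ← add_assoc]
    congr 1
    rw [Multiset.coe_add, Multiset.coe_eq_coe, List.perm_iff_count]
    intro x
    simp only [List.count_append, List.count_cons]
    omega
  · intro d hd x hx
    rcases Multiset.mem_cons.1 hd with rfl | hd
    · have hx' := hc₁.mem_iff.1 hx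
      rw [hσ x (by grind), List.formPerm_eq_of_isRotated (hc₁.nodup_iff.2 hn₁) hc₁]
      have := List.formPerm_apply_mem_of_mem hx'
      exact List.formPerm_apply_of_notMem (by grind)
    rcases Multiset.mem_cons.1 hd with rfl | hd
    · have hx' := hc₂.mem_iff.1 hx
      rw [hσ x (by grind), List.formPerm_eq_of_isRotated (hc₂.nodup_iff.2 hn₂) hc₂,
        List.formPerm_apply_of_notMem (l := a :: l₂) (by grind)]
    · have hxa : x ≠ a := fun e => h.notMem_of_mem ha hd (e ▸ hx)
      have hxb : x ≠ b := fun e => h.notMem_of_mem hb hd (e ▸ hx)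
      rw [Perm.mul_apply, Equiv.swap_apply_of_ne_of_ne hxa hxb]
      exact h.apply_eq d (Multiset.mem_cons_of_mem hd) x hx

lemma merge (h : IsCycleDecomposition σ (c₁ ::ₘ c₂ ::ₘ cs)) {l₁ l₂ : List α}
    (hc₁ : (c₁.1 :: c₁.2) ~r (a :: l₂)) (hc₂ : (c₂.1 :: c₂.2) ~r (b :: l₁)) :
    IsCycleDecomposition (σ * Equiv.swap a b) ((a, l₁ ++ b :: l₂) ::ₘ cs) := by
  have hbind : (((a :: (l₁ ++ b :: l₂) : List α) : Multiset α)) +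
      cs.bind (fun c => ((c.1 :: c.2 : List α) : Multiset α)) = univ.val := by
    rw [← h.bind_eq]
    simp only [Multiset.cons_bind]
    rw [Multiset.coe_eq_coe.2 hc₁.perm, Multiset.coe_eq_coe.2 hc₂.perm, ← add_assoc]
    congr 1
    rw [Multiset.coe_add, Multiset.coe_eq_coe, List.perm_iff_count]
    intro x
    simp only [List.count_append, List.count_cons]
    omega
  have hnd := univ.nodup (α := α)
  rw [← hbind, Multiset.nodup_add] at hnd
  obtain ⟨hn, -, hdisj⟩ := hnd
  replace hn : (a :: l₁ ++ b :: l₂).Nodup := hn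
  have h' : IsCycleDecomposition σ (c₂ ::ₘ c₁ ::ₘ cs) := by rwa [Multiset.cons_swap]
  have hσ : ∀ x ∈ a :: l₁ ++ b :: l₂, σ x = (b :: l₁).formPerm ((a :: l₂).formPerm x) := by
    intro x hx
    by_cases hx' : x ∈ a :: l₂
    · rw [h.apply_eq_of_mem_rotated hc₁ hx']
      have := List.formPerm_apply_mem_of_mem hx'
      exact (List.formPerm_apply_of_notMem (by grind)).symm
    · rw [List.formPerm_apply_of_notMem hx']
      exact h'.apply_eq_of_mem_rotated hc₂ (by grind)
  refine ⟨by rw [Multiset.cons_bind]; exact hbind, ?_⟩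
  intro d hd x hx
  rcases Multiset.mem_cons.1 hd with rfl | hd
  · rw [Perm.mul_apply, hσ, ← Perm.mul_apply, ← List.formPerm_mul_swap hn, Perm.mul_apply,
      Equiv.swap_apply_self]
    · rfl
    · change x ∈ a :: l₁ ++ b :: l₂ at hx
      rw [Equiv.swap_apply_def]
      split_ifs <;> simp_all
  · have hx' : x ∉ a :: (l₁ ++ b :: l₂) := fun hx' =>
      Multiset.disjoint_left.1 hdisj hx' (Multiset.mem_bind.2 ⟨d, hd, hx⟩)
    rw [Perm.mul_apply, Equiv.swap_apply_of_ne_of_ne (by grind) (by grind)]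
    exact h.apply_eq d (by simp [hd]) x hx

lemma exists_merge (h : IsCycleDecomposition σ (c ::ₘ cs)) (ha : a ∈ c.1 :: c.2)
    (hb : b ∉ c.1 :: c.2) : ∃ cs', IsCycleDecomposition (σ * Equiv.swap a b) cs' ∧
      reflectionLength cs' = reflectionLength (c ::ₘ cs) + 1 := by
  obtain ⟨c₂, hc₂, hb₂⟩ := h.exists_mem b
  have hc₂' : c₂ ∈ cs := by
    rcases Multiset.mem_cons.1 hc₂ with rfl | h₂
    · exact absurd hb₂ hb
    · exact h₂
  obtain ⟨cs, rfl⟩ := Multiset.exists_cons_of_mem hc₂'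
  obtain ⟨l₂, hl₂⟩ := List.exists_isRotated_cons ha
  obtain ⟨l₁, hl₁⟩ := List.exists_isRotated_cons hb₂
  refine ⟨_, h.merge hl₂ hl₁, ?_⟩
  have e₁ := hl₁.perm.length_eq
  have e₂ := hl₂.perm.length_eq
  simp only [List.length_cons, add_left_inj] at e₁ e₂
  simp only [reflectionLength, Multiset.map_cons, Multiset.sum_cons, List.length_append,
    List.length_cons, e₁, e₂]
  ring

lemma exists_mul_swap (h : IsCycleDecomposition σ cs) (hab : a ≠ b) :
    ∃ cs', IsCycleDecomposition (σ * Equiv.swap a b) cs' ∧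
      reflectionLength cs ≤ reflectionLength cs' + 1 := by
  obtain ⟨c, hc, ha⟩ := h.exists_mem a
  obtain ⟨cs, rfl⟩ := Multiset.exists_cons_of_mem hc
  by_cases hb : b ∈ c.1 :: c.2
  · obtain ⟨t, ht⟩ := List.exists_isRotated_cons ha
    have hbt : b ∈ t := by
      have := ht.mem_iff.1 hb
      simp_all [Ne.symm hab]
    obtain ⟨l₁, l₂, rfl⟩ := List.append_of_mem hbt
    refine ⟨_, h.split (c₁ := (a, l₂)) (c₂ := (b, l₁)) ht (List.IsRotated.refl _)
      (List.IsRotated.refl _), ?_⟩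
    have e := ht.perm.length_eq
    simp only [List.length_cons, List.length_append, add_left_inj] at e
    simp only [reflectionLength, Multiset.map_cons, Multiset.sum_cons, e]
    omega
  · obtain ⟨cs', h', e⟩ := h.exists_merge ha hb
    exact ⟨cs', h', by omega⟩

lemma eq_one_iff (h : IsCycleDecomposition σ cs) : σ = 1 ↔ reflectionLength cs = 0 := by
  rw [reflectionLength, Multiset.sum_eq_zero_iff]
  simp only [Multiset.mem_map, forall_exists_index, and_imp, forall_apply_eq_imp_iff₂,
    List.length_eq_zero_iff]
  constructor
  · rintro rfl ⟨x, t⟩ hc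
    rcases t with _ | ⟨y, t⟩
    · rfl
    · obtain ⟨cs, rfl⟩ := Multiset.exists_cons_of_mem hc
      have hn := h.nodup_cons
      have := h.apply_eq _ hc x (by simp)
      rw [List.formPerm_apply_head _ _ _ hn] at this
      simp_all
  · intro h0
    ext x
    obtain ⟨⟨a, t⟩, hc, ha⟩ := h.exists_mem x
    rw [h.apply_eq _ hc x ha]
    have : t = [] := h0 _ hc
    simp [this]

end IsCycleDecomposition

end CycleDecomposition

section FactorizationSum

variable {α : Type*} [DecidableEq α] [Fintype α] {R : Type*} [CommRing R]

lemma two_mul_sum_isSwap [DecidablePred (Perm.IsSwap (α := α))] (f : Perm α → R) :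
    2 * ∑ τ with Perm.IsSwap τ, f τ =
      ∑ a, ∑ b, if a = b then 0 else f (Equiv.swap a b) := by
  rw [← Fintype.sum_prod_type' (f := fun a b => if a = b then 0 else f (Equiv.swap a b))]
  have h : ∑ p : α × α, (if p.1 = p.2 then 0 else f (Equiv.swap p.1 p.2)) =
      ∑ p : α × α with p.1 ≠ p.2, f (Equiv.swap p.1 p.2) := by
    rw [Finset.sum_filter]
    exact Finset.sum_congr rfl fun p _ => by by_cases h : p.1 = p.2 <;> simp [h]
  rw [h, ← Finset.sum_fiberwise_of_maps_to (t := univ.filter Perm.IsSwap)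
    (g := fun p : α × α => Equiv.swap p.1 p.2), Finset.mul_sum]
  · refine Finset.sum_congr rfl fun τ hτ => ?_
    obtain ⟨a, b, hab, rfl⟩ := (Finset.mem_filter.1 hτ).2
    have : ((univ.filter fun p : α × α => p.1 ≠ p.2).filter
        fun p => Equiv.swap p.1 p.2 = Equiv.swap a b) = {(a, b), (b, a)} := by
      ext ⟨c, d⟩
      simp only [Finset.mem_filter, Finset.mem_univ, true_and, Finset.mem_insert,
        Finset.mem_singleton, Prod.mk.injEq]
      constructor
      · rintro ⟨hcd, e⟩
        have e₁ := congrArg (fun σ : Perm α => σ c) e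
        have e₂ := congrArg (fun σ : Perm α => σ d) e
        simp only [Equiv.swap_apply_left, Equiv.swap_apply_right, Equiv.swap_apply_def] at e₁ e₂
        grind
      · rintro (⟨rfl, rfl⟩ | ⟨rfl, rfl⟩)
        · exact ⟨hab, rfl⟩
        · exact ⟨hab.symm, Equiv.swap_comm _ _⟩
    rw [this, Finset.sum_pair (by simp [hab]), Equiv.swap_comm b a, two_mul]
  · rintro p hp
    exact Finset.mem_filter.2 ⟨mem_univ _, p.1, p.2, (Finset.mem_filter.1 hp).2, rfl⟩

/-- The sum of `g a b` over all pairs of entries of a list with `a` before `b`. -/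
def List.sumPairs (g : α → α → R) : List α → R
  | [] => 0
  | a :: t => (t.map (g a)).sum + t.sumPairs g

omit [DecidableEq α] [Fintype α] in
lemma List.sum_map_sum_map {g : α → α → R} (hs : ∀ a b, g a b = g b a) (h0 : ∀ a, g a a = 0)
    (l : List α) : (l.map fun a => (l.map (g a)).sum).sum = 2 * l.sumPairs g := by
  induction l with
  | nil => simp [List.sumPairs]
  | cons a t ih =>
    simp only [List.map_cons, List.sum_cons, h0, List.sum_map_add, ih, List.sumPairs]
    rw [List.map_congr_left (fun b _ => hs b a)]
    ring

omit [DecidableEq α] [Fintype α] in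
lemma List.sum_map_eq_sum_range {f : α → R} {A : ℕ → R} {t : List α}
    (h : ∀ l₁ b l₂, t = l₁ ++ b :: l₂ → f b = A l₁.length) :
    (t.map f).sum = ∑ i ∈ Finset.range t.length, A i := by
  induction t generalizing A with
  | nil => simp
  | cons a t ih =>
    rw [List.map_cons, List.sum_cons, List.length_cons, Finset.sum_range_succ',
      h [] a t rfl, ih (A := fun i => A (i + 1))]
    · simp [add_comm]
    · rintro l₁ b l₂ rfl
      exact h (a :: l₁) b l₂ rfl

omit [DecidableEq α] [Fintype α] in
lemma List.sumPairs_eq_sum_range {g : α → α → R} {B : ℕ → R} {t : List α}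
    (h : ∀ l₀ a l₁ b l₂, t = l₀ ++ a :: (l₁ ++ b :: l₂) → g a b = B l₁.length) :
    t.sumPairs g = ∑ i ∈ Finset.range t.length, ((t.length - 1 - i : ℕ) : R) * B i := by
  induction t with
  | nil => simp [List.sumPairs]
  | cons a t ih =>
    rw [List.sumPairs, List.sum_map_eq_sum_range (fun l₁ b l₂ e => h [] a l₁ b l₂ (by simp [e])),
      ih (fun l₀ a' l₁ b l₂ e => h (a :: l₀) a' l₁ b l₂ (by simp [e])), List.length_cons,
      Finset.sum_range_succ, ← Finset.sum_add_distrib]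
    simp only [Nat.add_sub_cancel, Nat.sub_self, Nat.cast_zero, zero_mul, add_zero]
    refine Finset.sum_congr rfl fun i hi => ?_
    have : t.length - i = (t.length - 1 - i) + 1 := by
      have := Finset.mem_range.1 hi
      omega
    rw [this]
    push_cast
    ring

open Classical in
/-- The sum of `x ^ T * y ^ M` over all factorizations of `σ` into `k` transpositions, where `T`
counts the transpositions moving `u` and `M` those affecting the trajectory of `v`. -/
noncomputable def factorizationSum (x y : R) (u : α) : ℕ → Perm α → α → R
  | 0, σ, _ => if σ = 1 then 1 else 0
  | k + 1, σ, v => ∑ τ with Perm.IsSwap τ, (if τ u ≠ u then x else 1) *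
      (if τ v ≠ v then y else 1) * factorizationSum x y u k (σ * τ) (τ v)

open IsCycleDecomposition

open Classical in
lemma factorizationSum_eq_zero (x y : R) (u : α) {k : ℕ} {σ : Perm α}
    {cs : Multiset (α × List α)} (h : IsCycleDecomposition σ cs) (hk : k < reflectionLength cs)
    (v : α) : factorizationSum x y u k σ v = 0 := by
  induction k generalizing σ cs v with
  | zero => simp [factorizationSum, h.eq_one_iff, hk.ne']
  | succ k ih =>
    refine Finset.sum_eq_zero fun τ hτ => ?_
    obtain ⟨a, b, hab, rfl⟩ := (Finset.mem_filter.1 hτ).2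
    obtain ⟨cs', h', hle⟩ := h.exists_mul_swap hab
    rw [ih h' (by omega), mul_zero]

variable [Algebra ℚ R]

/-- The contribution of a cycle to `factorizationSum`. -/
noncomputable def markedWeight (x y : R) (u v : α) (c : α × List α) : R :=
  cycleWeight c.2.length (if c.1 = u then x else 1) (if c.1 = v then y else 1)

variable {x y : R} {u v : α} {k : ℕ} {σ : Perm α}

/-- The summand of `2 * factorizationSum x y u (k + 1) σ v` for the transposition `(a b)`. -/
noncomputable def swapTerm (x y : R) (u v : α) (k : ℕ) (σ : Perm α) (a b : α) : R :=
  if a = b then 0 else (if Equiv.swap a b u ≠ u then x else 1) *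
    (if Equiv.swap a b v ≠ v then y else 1) *
    factorizationSum x y u k (σ * Equiv.swap a b) (Equiv.swap a b v)

omit [Algebra ℚ R] in
lemma swapTerm_comm (a b : α) : swapTerm x y u v k σ a b = swapTerm x y u v k σ b a := by
  simp only [swapTerm, Equiv.swap_comm a b, eq_comm (a := a)]

omit [Algebra ℚ R] in
open Classical in
lemma two_mul_factorizationSum :
    2 * factorizationSum x y u (k + 1) σ v = ∑ a, ∑ b, swapTerm x y u v k σ a b :=
  two_mul_sum_isSwap _

/-- `u` and `v` can only be at the head of a cycle. -/
def HeadsMarked (u v : α) (cs : Multiset (α × List α)) : Prop :=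
  ∀ c ∈ cs, u ∉ c.2 ∧ v ∉ c.2

/-- The value of `factorizationSum` in the minimal case. -/
def HasProductFormula (x y : R) (u : α) (k : ℕ) : Prop :=
  ∀ (σ : Perm α) (v : α) (cs : Multiset (α × List α)), IsCycleDecomposition σ cs →
    reflectionLength cs = k → HeadsMarked u v cs →
    factorizationSum x y u k σ v = (k.factorial : R) * (cs.map (markedWeight x y u v)).prod

lemma swapTerm_of_head (ih : HasProductFormula x y u k) {a b : α} {l₁ l₂ : List α}
    {cs : Multiset (α × List α)} (h : IsCycleDecomposition σ ((a, l₁ ++ b :: l₂) ::ₘ cs))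
    (hk : reflectionLength ((a, l₁ ++ b :: l₂) ::ₘ cs) = k + 1)
    (hm : HeadsMarked u v ((a, l₁ ++ b :: l₂) ::ₘ cs)) :
    swapTerm x y u v k σ a b = k.factorial * (cs.map (markedWeight x y u v)).prod *
      ((if a = u then x else 1) * (if a = v then y else 1) *
        (cycleWeight l₂.length (if a = u then x else 1) 1 *
          cycleWeight l₁.length 1 (if a = v then y else 1))) := by
  have hn : (a :: (l₁ ++ b :: l₂)).Nodup := h.nodup_cons
  have hab : a ≠ b := by grind
  have hd : ∀ d ∈ cs, a ∉ d.1 :: d.2 ∧ b ∉ d.1 :: d.2 := fun d hd =>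
    ⟨h.notMem_of_mem (by simp) hd, h.notMem_of_mem (by simp) hd⟩
  obtain ⟨hu, hv⟩ := hm _ (Multiset.mem_cons_self _ _)
  have hm' : ∀ d ∈ cs, u ∉ d.2 ∧ v ∉ d.2 := fun d hd => hm d (Multiset.mem_cons_of_mem hd)
  have hub : b ≠ u := by grind
  have hvb : b ≠ v := by grind
  have h' := h.split (c₁ := (a, l₂)) (c₂ := (b, l₁)) (List.IsRotated.refl _)
    (List.IsRotated.refl _) (List.IsRotated.refl _)
  have hsu : Equiv.swap a b u ≠ u ↔ a = u := by
    rw [Equiv.swap_apply_def]; grind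
  have hsv : Equiv.swap a b v ≠ v ↔ a = v := by
    rw [Equiv.swap_apply_def]; grind
  have hv' : Equiv.swap a b v = if a = v then b else v := by
    rw [Equiv.swap_apply_def]; grind
  rw [swapTerm, if_neg hab, ih _ _ _ h']
  · have hcs : cs.map (markedWeight x y u (Equiv.swap a b v)) =
        cs.map (markedWeight x y u v) := by
      refine Multiset.map_congr rfl fun d hd' => ?_
      have hdv : d.1 = Equiv.swap a b v ↔ d.1 = v := by
        have := hd d hd'
        rw [hv']
        grind
      simp only [markedWeight, hdv]
    have h₁ : a ≠ Equiv.swap a b v := by rw [hv']; grind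
    have h₂ : b = Equiv.swap a b v ↔ a = v := by rw [hv']; grind
    simp only [Multiset.map_cons, Multiset.prod_cons, hcs, hsu, hsv]
    simp only [markedWeight, h₁, h₂, hub, if_false]
    ring
  · simp only [reflectionLength, Multiset.map_cons, Multiset.sum_cons, List.length_append,
      List.length_cons] at hk ⊢
    omega
  · intro d hd'
    rw [hv']
    rcases Multiset.mem_cons.1 hd' with rfl | hd'
    · grind
    rcases Multiset.mem_cons.1 hd' with rfl | hd'
    · grind
    · have := hd d hd'
      have := hm' d hd'
      grind

lemma swapTerm_of_tail (ih : HasProductFormula x y u k) {a b c : α} {l₀ l₁ l₂ : List α}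
    {cs : Multiset (α × List α)}
    (h : IsCycleDecomposition σ ((c, l₀ ++ a :: (l₁ ++ b :: l₂)) ::ₘ cs))
    (hk : reflectionLength ((c, l₀ ++ a :: (l₁ ++ b :: l₂)) ::ₘ cs) = k + 1)
    (hm : HeadsMarked u v ((c, l₀ ++ a :: (l₁ ++ b :: l₂)) ::ₘ cs)) :
    swapTerm x y u v k σ a b = k.factorial * (cs.map (markedWeight x y u v)).prod *
      (cycleWeight (l₀ ++ a :: l₂).length (if c = u then x else 1) (if c = v then y else 1) *
          cycleWeight l₁.length 1 1) := by
  have hn : (c :: (l₀ ++ a :: (l₁ ++ b :: l₂))).Nodup := h.nodup_cons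
  have hab : a ≠ b := by grind
  obtain ⟨hu, hv⟩ := hm _ (Multiset.mem_cons_self _ _)
  have hm' : ∀ d ∈ cs, u ∉ d.2 ∧ v ∉ d.2 := fun d hd => hm d (Multiset.mem_cons_of_mem hd)
  have hub : b ≠ u := by grind
  have hvb : b ≠ v := by grind
  have h' := h.split (a := a) (b := b) (l₁ := l₁) (l₂ := l₂ ++ c :: l₀)
    (c₁ := (c, l₀ ++ a :: l₂)) (c₂ := (b, l₁))
    ⟨(c :: l₀).length, by
      change ((c :: l₀) ++ a :: (l₁ ++ b :: l₂)).rotate _ = _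
      rw [List.rotate_append_length_eq]; simp⟩
    ⟨(c :: l₀).length, by
      change ((c :: l₀) ++ a :: l₂).rotate _ = _
      rw [List.rotate_append_length_eq]; simp⟩ (List.IsRotated.refl _)
  have hsu : Equiv.swap a b u = u := Equiv.swap_apply_of_ne_of_ne (by grind) (by grind)
  have hsv : Equiv.swap a b v = v := Equiv.swap_apply_of_ne_of_ne (by grind) (by grind)
  rw [swapTerm, if_neg hab, ih _ _ _ h', hsu, hsv]
  · simp only [Multiset.map_cons, Multiset.prod_cons]
    simp only [markedWeight, hub, hvb, if_false, ne_eq, not_true_eq_false]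
    ring
  · simp only [reflectionLength, Multiset.map_cons, Multiset.sum_cons, List.length_append,
      List.length_cons] at hk ⊢
    omega
  · intro d hd'
    rw [hsv]
    rcases Multiset.mem_cons.1 hd' with rfl | hd'
    · grind
    rcases Multiset.mem_cons.1 hd' with rfl | hd'
    · grind
    · exact hm' d hd'

omit [Algebra ℚ R] in
lemma sum_swapTerm {c : α × List α} {cs : Multiset (α × List α)}
    (h : IsCycleDecomposition σ (c ::ₘ cs)) (hk : reflectionLength (c ::ₘ cs) = k + 1) {a : α}
    (ha : a ∈ c.1 :: c.2) :
    ∑ b, swapTerm x y u v k σ a b = ((c.1 :: c.2).map (swapTerm x y u v k σ a)).sum := by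
  change (univ.val.map _).sum = _
  rw [← h.bind_eq, Multiset.cons_bind, Multiset.map_add, Multiset.sum_add]
  refine (congrArg _ (Multiset.sum_eq_zero fun r hr => ?_)).trans (add_zero _)
  obtain ⟨b, hb, rfl⟩ := Multiset.mem_map.1 hr
  obtain ⟨d, hd, hb⟩ := Multiset.mem_bind.1 hb
  have hbc : b ∉ c.1 :: c.2 := fun hbc => h.notMem_of_mem hbc hd hb
  obtain ⟨cs', h', e⟩ := h.exists_merge ha hbc
  rw [swapTerm, factorizationSum_eq_zero x y u h' (by omega), mul_zero, ite_self]

variable [IsDomain R] [CharZero R]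

lemma sum_sum_swapTerm (ih : HasProductFormula x y u k) {c : α × List α}
    {cs : Multiset (α × List α)}
    (h : IsCycleDecomposition σ (c ::ₘ cs)) (hk : reflectionLength (c ::ₘ cs) = k + 1)
    (hm : HeadsMarked u v (c ::ₘ cs)) :
    ((c.1 :: c.2).map fun a => ∑ b, swapTerm x y u v k σ a b).sum =
      2 * (k.factorial * c.2.length * ((c ::ₘ cs).map (markedWeight x y u v)).prod) := by
  obtain ⟨a, t⟩ := c
  rw [List.map_congr_left (fun b hb => sum_swapTerm h hk hb),
    List.sum_map_sum_map swapTerm_comm (fun a => if_pos rfl), List.sumPairs,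
    List.sum_map_eq_sum_range (A := fun i =>
      k.factorial * (cs.map (markedWeight x y u v)).prod *
      ((if a = u then x else 1) * (if a = v then y else 1) *
        (cycleWeight (t.length - 1 - i) (if a = u then x else 1) 1 *
          cycleWeight i 1 (if a = v then y else 1)))),
    List.sumPairs_eq_sum_range (B := fun i =>
      k.factorial * (cs.map (markedWeight x y u v)).prod *
      (cycleWeight (t.length - 1 - i) (if a = u then x else 1) (if a = v then y else 1) *
          cycleWeight i 1 1))]
  · rw [Multiset.map_cons, Multiset.prod_cons]
    simp only [markedWeight]
    have := sum_cycleWeight t.length (if a = u then x else 1) (if a = v then y else 1)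
    simp only [mul_left_comm _ (_ * (cs.map (markedWeight x y u v)).prod), ← Finset.mul_sum,
      ← mul_add]
    rw [← Finset.mul_sum] at this
    rw [this]
    ring
  · rintro l₀ b l₁ b' l₂ rfl
    rw [swapTerm_of_tail ih h hk hm]
    congr 3
    simp only [List.length_append, List.length_cons]
    omega
  · rintro l₁ b l₂ rfl
    rw [swapTerm_of_head ih h hk hm]
    congr 4
    simp only [List.length_append, List.length_cons]
    omega

theorem hasProductFormula (x y : R) (u : α) (k : ℕ) : HasProductFormula x y u k := by
  induction k with
  | zero =>
    intro σ v cs h hk hm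
    rw [factorizationSum, if_pos (h.eq_one_iff.2 hk), Multiset.prod_eq_one]
    · simp
    · intro r hr
      obtain ⟨c, hc, rfl⟩ := Multiset.mem_map.1 hr
      have : c.2.length = 0 :=
        Multiset.sum_eq_zero_iff.1 hk _ (Multiset.mem_map_of_mem _ hc)
      simp [markedWeight, this, cycleWeight]
  | succ k ih =>
    intro σ v cs h hk hm
    refine mul_left_cancel₀ (two_ne_zero (α := R)) ?_
    rw [two_mul_factorizationSum]
    change (univ.val.map _).sum = _
    rw [← h.bind_eq, Multiset.map_bind, Multiset.sum_bind]
    rw [Multiset.map_congr rfl (g := fun c : α × List α =>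
      (c.2.length : R) * (2 * (k.factorial * (cs.map (markedWeight x y u v)).prod)))]
    · rw [Multiset.sum_map_mul_right]
      have : (cs.map fun c => (c.2.length : R)).sum = ((k + 1 : ℕ) : R) := by
        rw [← hk, reflectionLength, Nat.cast_multiset_sum, Multiset.map_map]
        rfl
      rw [this, Nat.factorial_succ]
      push_cast
      ring
    · intro c hc
      obtain ⟨cs, rfl⟩ := Multiset.exists_cons_of_mem hc
      rw [Multiset.map_coe, Multiset.sum_coe, sum_sum_swapTerm ih h hk hm]
      ring

end FactorizationSum

section MinimalFactorizations

variable {α : Type*} [DecidableEq α]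

/-- The number of permutations in `F` moving `u`. -/
def moveCount {k : ℕ} (F : Fin k → Perm α) (u : α) : ℕ :=
  (univ.filter fun i : Fin k => F i u ≠ u).card

/-- The number of permutations in `F` affecting the trajectory of `v`. -/
def trajectoryCount {k : ℕ} (F : Fin k → Perm α) (v : α) : ℕ :=
  (univ.filter fun i : Fin k => ((List.ofFn F).take i.val).reverse.prod v ≠
    ((List.ofFn F).take (i.val + 1)).reverse.prod v).card

lemma moveCount_cons {k : ℕ} (τ : Perm α) (F : Fin k → Perm α) (u : α) :
    moveCount (Fin.cons τ F : Fin (k + 1) → Perm α) u =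
      (if τ u ≠ u then 1 else 0) + moveCount F u := by
  simp only [moveCount, Finset.card_filter, Fin.sum_univ_succ, Fin.cons_zero, Fin.cons_succ]

lemma trajectoryCount_cons {k : ℕ} (τ : Perm α) (F : Fin k → Perm α) (v : α) :
    trajectoryCount (Fin.cons τ F : Fin (k + 1) → Perm α) v =
      (if τ v ≠ v then 1 else 0) + trajectoryCount F (τ v) := by
  simp only [trajectoryCount, Finset.card_filter, Fin.sum_univ_succ, List.ofFn_succ,
    Fin.cons_zero, Fin.cons_succ]
  simp [eq_comm]

variable [Fintype α] {R : Type*} [CommRing R]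

open Classical in
lemma factorizationSum_eq_sum (x y : R) (u : α) (k : ℕ) (σ : Perm α) (v : α) :
    factorizationSum x y u k σ v =
      ∑ F : Fin k → Perm α with (∀ i, (F i).IsSwap) ∧ (List.ofFn F).reverse.prod = σ,
        x ^ moveCount F u * y ^ trajectoryCount F v := by
  induction k generalizing σ v with
  | zero =>
    by_cases h : σ = 1
    · simp [factorizationSum, moveCount, trajectoryCount, h]
    · simp [factorizationSum, moveCount, trajectoryCount, h, Ne.symm h]
  | succ k ih =>
    rw [factorizationSum, Finset.sum_filter, Finset.sum_filter,
      ← (Fin.consEquiv fun _ => Perm α).sum_comp, Fintype.sum_prod_type]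
    refine Finset.sum_congr rfl fun τ _ => ?_
    by_cases hτ : τ.IsSwap
    · rw [if_pos hτ, ih, Finset.mul_sum, Finset.sum_filter]
      refine Finset.sum_congr rfl fun F _ => ?_
      have hτ' : τ⁻¹ = τ := by
        obtain ⟨a, b, -, rfl⟩ := hτ
        exact Equiv.swap_inv a b
      have hσ : (List.ofFn F).reverse.prod = σ * τ ↔ (List.ofFn F).reverse.prod * τ = σ := by
        rw [← eq_mul_inv_iff_mul_eq, hτ']
      have hc : Fin.consEquiv (fun _ => Perm α) (τ, F) = (Fin.cons τ F : Fin (k + 1) → Perm α) :=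
        rfl
      rw [hc, moveCount_cons, trajectoryCount_cons]
      simp only [Fin.forall_fin_succ, Fin.cons_zero, Fin.cons_succ, hτ,
        true_and, List.ofFn_succ, List.reverse_cons, List.prod_append, List.prod_singleton, hσ,
        pow_add]
      refine if_congr Iff.rfl ?_ rfl
      by_cases h₁ : τ u = u <;> by_cases h₂ : τ v = v <;>
        simp only [h₁, h₂, ne_eq, not_true_eq_false, not_false_eq_true, if_true, if_false] <;> ring
    · rw [if_neg hτ]
      refine (Finset.sum_eq_zero fun F _ => if_neg fun h => hτ ?_).symm
      exact h.1 0

lemma isCycleDecomposition_finRotate (m : ℕ) :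
    IsCycleDecomposition (finRotate (m + 2))
      {((0 : Fin (m + 2)), (List.finRange (m + 1)).map Fin.succ)} := by
  have hl : (0 : Fin (m + 2)) :: (List.finRange (m + 1)).map Fin.succ = List.finRange (m + 2) :=
    (List.finRange_succ).symm
  refine ⟨by simp only [Multiset.singleton_bind, hl]; rfl, fun c hc a _ => ?_⟩
  rw [Multiset.mem_singleton.1 hc, hl, finRotate_apply]
  have h := List.formPerm_apply_getElem (List.finRange (m + 2)) (List.nodup_finRange _) a
    (by simp)
  simp only [List.getElem_finRange, List.length_finRange] at h
  rw [Fin.ext_iff] at h ⊢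
  simp [Fin.val_add] at h ⊢
  rw [h]

lemma factorizationSum_finRotate [Algebra ℚ R] [IsDomain R] [CharZero R] (x y : R) (m : ℕ) :
    factorizationSum x y 0 (m + 1) (finRotate (m + 2)) 0 = x * y * (x + y + m) ^ m := by
  rw [hasProductFormula x y 0 (m + 1) _ 0 _ (isCycleDecomposition_finRotate m)
    (by simp [reflectionLength]) (by intro c hc; rw [Multiset.mem_singleton.1 hc]; simp)]
  simp only [Multiset.map_singleton, Multiset.prod_singleton, markedWeight, List.length_map,
    List.length_finRange, if_true, cycleWeight]
  rw [← nsmul_eq_mul, ← Nat.cast_smul_eq_nsmul ℚ, smul_smul, mul_inv_cancel₀, one_smul]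
  exact_mod_cast (m + 1).factorial_ne_zero

theorem card_isMinFact (m i j : ℕ) :
    Nat.card {F : Fin ((m + 2) - 1) → Perm (Fin (m + 2)) //
      IsMinFact (m + 2) F ∧ Tcount F ⟨0, by omega⟩ = i + 1 ∧ Mcount F ⟨0, by omega⟩ = j + 1} =
      m ^ (m - j - i) * (m - j).choose i * m.choose j := by
  classical
  have h := factorizationSum_finRotate (C X : ℚ[X][X]) X m
  rw [factorizationSum_eq_sum] at h
  replace h := congrArg (fun p => (p.coeff (j + 1)).coeff (i + 1)) h
  have e : (C X * X * (C X + X + (m : ℚ[X][X])) ^ m : ℚ[X][X]) =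
      C X * (X * (X + C (X + C (m : ℚ))) ^ m) := by
    simp only [C_add, map_natCast]
    ring
  simp only [e, coeff_C_mul, coeff_X_mul, coeff_X_add_C_pow, coeff_mul_natCast, finsetSum_coeff,
    ← C_pow] at h
  rw [Nat.card_eq_fintype_card, Fintype.card_subtype]
  rw [← Nat.cast_inj (R := ℚ)]
  push_cast
  rw [← h, Finset.card_filter, Finset.sum_filter]
  push_cast
  refine Finset.sum_congr rfl fun (F : Fin (m + 1) → Perm (Fin (m + 2))) _ => ?_
  have hF : IsMinFact (m + 2) F ∧ Tcount (n := m + 2) F ⟨0, by omega⟩ = i + 1 ∧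
      Mcount (n := m + 2) F ⟨0, by omega⟩ = j + 1 ↔
      ((∀ i : Fin (m + 1), (F i).IsSwap) ∧
        (List.ofFn (n := m + 1) F).reverse.prod = finRotate (m + 2)) ∧
        i + 1 = moveCount (k := m + 1) F 0 ∧ j + 1 = trajectoryCount (k := m + 1) F 0 := by
    rw [eq_comm (a := i + 1), eq_comm (a := j + 1)]
    rfl
  rw [if_congr hF rfl rfl]
  by_cases h₁ : (∀ i : Fin (m + 1), (F i).IsSwap) ∧
      (List.ofFn (n := m + 1) F).reverse.prod = finRotate (m + 2)
  · refine Eq.trans ?_ (if_pos h₁).symm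
    rw [if_congr (and_iff_right h₁) rfl rfl, coeff_X_pow]
    by_cases h₂ : j + 1 = trajectoryCount (k := m + 1) F 0 <;> simp [h₂, coeff_X_pow]
  · exact (if_neg fun h => h₁ h.1).trans (if_neg h₁).symm

end MinimalFactorizations

lemma choose_mul_choose_mul_factorial (m i j : ℕ) :
    (m - j).choose i * m.choose j * (i.factorial * j.factorial) = m.descFactorial (j + i) := by
  rw [← Nat.descFactorial_mul_descFactorial (Nat.le_add_right j i), Nat.add_sub_cancel_left,
    Nat.descFactorial_eq_factorial_mul_choose, Nat.descFactorial_eq_factorial_mul_choose]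
  ring

open Filter Topology in
lemma tendsto_div_add_two_pow :
    Tendsto (fun m : ℕ => ((m : ℝ) / (m + 2)) ^ m) atTop (𝓝 (Real.exp (-2))) := by
  rw [Real.exp_neg]
  refine ((Real.tendsto_one_add_div_pow_exp 2).inv₀ (Real.exp_pos 2).ne').congr' ?_
  filter_upwards [eventually_gt_atTop 0] with m hm
  rw [← inv_pow]
  congr 1
  field_simp

open Filter Topology in
lemma tendsto_descFactorial_div_pow (k : ℕ) :
    Tendsto (fun m : ℕ => (m.descFactorial k : ℝ) / (m : ℝ) ^ k) atTop (𝓝 1) := by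
  have := isEquivalent_descFactorial k
  rw [Asymptotics.isEquivalent_iff_tendsto_one] at this
  · exact this
  · filter_upwards [eventually_gt_atTop 0] with m hm
    positivity

end

/-- for `i, j ≥ 1`, the proportion of minimal factorizations of size
`n` with `T_1 = i` and `M_1 = j` tends to `e⁻² / ((i-1)! (j-1)!)` as `n → ∞`
(the sequence is indexed by `n = m + 2`; the element `1` of `{1,…,n}` is the index
`0 : Fin n`). This limit is the probability that a pair of two independent random
variables, each distributed as `1 + Poisson(1)`, equals `(i, j)`; hence the pair
`(T_1, M_1)` under the uniform distribution on minimal factorizations converges in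
distribution to such a pair. -/
theorem limit_T1_M1 (i j : ℕ) (hi : 1 ≤ i) (hj : 1 ≤ j) :
    Filter.Tendsto (fun m : ℕ =>
      (Nat.card {F : Fin ((m + 2) - 1) → Equiv.Perm (Fin (m + 2)) //
          IsMinFact (m + 2) F ∧ Tcount F ⟨0, by omega⟩ = i ∧
            Mcount F ⟨0, by omega⟩ = j} : ℝ) /
        ((m + 2 : ℝ) ^ ((m + 2) - 2)))
      Filter.atTop
      (nhds (Real.exp (-2) /
        ((Nat.factorial (i - 1) : ℝ) * (Nat.factorial (j - 1) : ℝ)))) := by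
  obtain ⟨i, rfl⟩ := Nat.exists_eq_add_of_le' hi
  obtain ⟨j, rfl⟩ := Nat.exists_eq_add_of_le' hj
  have h := (tendsto_div_add_two_pow.mul (tendsto_descFactorial_div_pow (j + i))).div_const
    ((i.factorial : ℝ) * j.factorial)
  rw [mul_one] at h
  refine h.congr' ?_
  filter_upwards [Filter.eventually_gt_atTop (j + i)] with m hm
  rw [card_isMinFact, ← choose_mul_choose_mul_factorial, Nat.add_sub_cancel]
  have hp : (m : ℝ) ^ m = m ^ (m - j - i) * m ^ (j + i) := by
    rw [← pow_add]
    congr 1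
    omega
  have hm0 : (0 : ℝ) < m := by exact_mod_cast (Nat.zero_le _).trans_lt hm
  rw [div_pow, hp]
  push_cast
  field_simp
end

section
/- For all integers i ≥ 1 and j ≥ 1, the sequence of real numbers n ↦ (number of minimal factorizations F ∈ 𝔐_n with T_1(F) = i and T_2(F) = j) / n^{n-2} converges, as n → ∞, to e^{-2} ( (i+j-2)/(i+j-1)! + (i+j-1)/(i! j!) - (i+j-1)/(i+j)! ). -/
namespace MinFact
open Equiv

section Bijection
variable {α β : Type} [LinearOrder α]

/-- The product of the transpositions `(a, b)` in a list, leftmost applied first. -/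
def prodSwaps (L : List (α × α)) : Perm α := (L.map fun p => swap p.1 p.2).reverse.prod

lemma prodSwaps_cons (a b : α) (L : List (α × α)) :
    prodSwaps ((a, b) :: L) = prodSwaps L * swap a b := by
  simp [prodSwaps]

lemma prodSwaps_eq_of_cons {a b : α} {L : List (α × α)} {σ : Perm α}
    (h : prodSwaps ((a, b) :: L) = σ) : prodSwaps L = σ * swap a b := by
  rw [← h, prodSwaps_cons, mul_assoc, swap_mul_self, mul_one]

/-- `σ` maps each `x` to its cyclic successor in the fibre of `ℓ` containing `x`. -/
def IsCyclicSucc (σ : Perm α) (ℓ : α → β) : Prop :=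
  ∀ x, ℓ (σ x) = ℓ x ∧ ((x < σ x ∧ ∀ y, ℓ y = ℓ x → x < y → σ x ≤ y) ∨
    ∀ y, ℓ y = ℓ x → σ x ≤ y ∧ y ≤ x)

/-- Refine the fibres of `ℓ` by separating the part of the fibre of `a` lying in `(a, b]`. -/
def split (ℓ : α → β) (a b : α) : α → β × Prop :=
  fun x => (ℓ x, ℓ x = ℓ a ∧ a < x ∧ x ≤ b)

lemma split_eq_iff {ℓ : α → β} {a b x y : α} :
    split ℓ a b x = split ℓ a b y ↔
      ℓ x = ℓ y ∧ ((ℓ x = ℓ a ∧ a < x ∧ x ≤ b) ↔ (ℓ y = ℓ a ∧ a < y ∧ y ≤ b)) := by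
  simp [split]

lemma IsCyclicSucc.split {σ : Perm α} {ℓ : α → β} (h : IsCyclicSucc σ ℓ) {a b : α}
    (hab : a < b) (hl : ℓ a = ℓ b) : IsCyclicSucc (σ * swap a b) (split ℓ a b) := by
  intro x
  have ha := h a
  have hb := h b
  have hx := h x
  simp only [split_eq_iff, Perm.mul_apply]
  by_cases hxa : x = a
  · subst hxa
    rw [swap_apply_left]
    grind
  by_cases hxb : x = b
  · subst hxb
    rw [swap_apply_right]
    grind
  rw [swap_apply_of_ne_of_ne hxa hxb]
  by_cases hla : ℓ x = ℓ a
  · rcases lt_or_gt_of_ne hxa with h1 | h1 <;> rcases lt_or_gt_of_ne hxb with h2 | h2 <;> grind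
  · grind

/-- A labelling of the connected components of the graph whose edges are the pairs in a list. -/
def component : List (α × α) → α → α
  | [], x => x
  | p :: L, x => if component L x = component L p.2 then component L p.1 else component L x

lemma component_edge {L : List (α × α)} {p : α × α} (hp : p ∈ L) :
    component L p.1 = component L p.2 := by
  induction L with
  | nil => simp at hp
  | cons q L ih =>
    rcases List.mem_cons.1 hp with rfl | h
    · simp [component]
    · simp [component, ih h]

lemma component_swap {L : List (α × α)} {p : α × α} (hp : p ∈ L) (x : α) :
    component L (swap p.1 p.2 x) = component L x := by
  have := component_edge hp
  rw [swap_apply_def]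
  grind

lemma component_prodSwaps {L M : List (α × α)} (hM : M ⊆ L) (x : α) :
    component L (prodSwaps M x) = component L x := by
  induction M generalizing x with
  | nil => simp [prodSwaps]
  | cons p M ih =>
    rw [List.cons_subset] at hM
    rw [prodSwaps_cons, Perm.mul_apply, ih hM.2, component_swap hM.1]

lemma IsCyclicSucc.fibre_le {γ : Type} {σ : Perm α} {ℓ : α → β} [Fintype α]
    (h : IsCyclicSucc σ ℓ) {ρ : α → γ} (hρ : ∀ x, ρ (σ x) = ρ x) {x y : α} (hxy : ℓ x = ℓ y) :
    ρ x = ρ y := by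
  have key : ∀ x, ∀ y, ℓ x = ℓ y → x ≤ y → ρ x = ρ y := by
    intro x
    induction x using (Finite.wellFounded_of_trans_of_irrefl (α := α) (· > ·)).induction with
    | _ x ih =>
      intro y hxy hle
      rcases eq_or_lt_of_le hle with rfl | hlt
      · rfl
      obtain ⟨h1, ⟨h2, h3⟩ | h2⟩ := h x
      · rw [← hρ x]
        exact ih _ h2 y (h1.trans hxy) (h3 y hxy.symm hlt)
      · exact absurd hlt (not_lt.2 (h2 y hxy.symm).2)
  rcases le_total x y with h1 | h1
  · exact key x y hxy h1
  · exact (key y x hxy.symm h1).symm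

variable [Fintype α]

open Classical in
/-- The minima of the fibres of `ℓ`. -/
noncomputable def minima (ℓ : α → β) : Finset α := {x | ∀ y, ℓ y = ℓ x → x ≤ y}

lemma exists_minima (ℓ : α → β) (x : α) : ∃ y ∈ minima ℓ, ℓ y = ℓ x := by
  classical
  obtain ⟨y, hy, hmin⟩ := Finset.exists_min_image ({y | ℓ y = ℓ x} : Finset α) id ⟨x, by simp⟩
  simp only [Finset.mem_filter, Finset.mem_univ, true_and, id] at hy hmin
  exact ⟨y, by simp only [minima, Finset.mem_filter, Finset.mem_univ, true_and]; grind, hy⟩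

lemma card_minima_split {σ : Perm α} {ℓ : α → β} (h : IsCyclicSucc σ ℓ) {a b : α}
    (hab : a < b) (hl : ℓ a = ℓ b) :
    (minima (split ℓ a b)).card = (minima ℓ).card + 1 := by
  classical
  have ha := h a
  have : minima (split ℓ a b) = insert (σ a) (minima ℓ) := by
    ext x
    simp only [minima, Finset.mem_filter, Finset.mem_univ, true_and, split_eq_iff,
      Finset.mem_insert]
    constructor
    · intro hx
      by_cases hxa : x = σ a
      · exact Or.inl hxa
      refine Or.inr fun y hy => ?_
      by_cases hc : ℓ x = ℓ a ∧ a < x ∧ x ≤ b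
      · grind
      · by_cases hy' : ℓ y = ℓ a ∧ a < y ∧ y ≤ b
        · have := hx a
          grind
        · grind
    · grind
  rw [this, Finset.card_insert_of_notMem]
  simp only [minima, Finset.mem_filter, Finset.mem_univ, true_and]
  grind

lemma card_le_card_image_component (L : List (α × α)) :
    Fintype.card α ≤ (Finset.univ.image (component L)).card + L.length := by
  induction L with
  | nil => simp [component, Finset.card_univ]
  | cons p L ih =>
    have : (Finset.univ.image (component L)).erase (component L p.2) ⊆
        Finset.univ.image (component (p :: L)) := by
      intro y hy
      simp only [Finset.mem_erase, Finset.mem_image, Finset.mem_univ, true_and] at hy ⊢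
      obtain ⟨hne, x, rfl⟩ := hy
      exact ⟨x, by simp [component, hne]⟩
    have h1 := Finset.card_le_card this
    have h2 := Finset.pred_card_le_card_erase (s := Finset.univ.image (component L))
      (a := component L p.2)
    simp only [List.length_cons]
    omega

/-- In a shortest factorization every transposition acts inside a cycle of the product. -/
lemma fibre_eq_of_mem {σ : Perm α} {ℓ : α → β} (h : IsCyclicSucc σ ℓ) {L : List (α × α)}
    (hL : prodSwaps L = σ) (hc : L.length + (minima ℓ).card = Fintype.card α)
    {p : α × α} (hp : p ∈ L) : ℓ p.1 = ℓ p.2 := by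
  have hρ : ∀ x, component L (σ x) = component L x := fun x =>
    hL ▸ component_prodSwaps (List.Subset.refl L) x
  have himg : Finset.univ.image (component L) = (minima ℓ).image (component L) := by
    ext y
    simp only [Finset.mem_image, Finset.mem_univ, true_and]
    constructor
    · rintro ⟨x, rfl⟩
      obtain ⟨z, hz, hzx⟩ := exists_minima ℓ x
      exact ⟨z, hz, h.fibre_le hρ hzx⟩
    · rintro ⟨x, -, rfl⟩
      exact ⟨x, rfl⟩
  have h1 := card_le_card_image_component L
  rw [himg] at h1
  have h2 := Finset.card_image_le (s := minima ℓ) (f := component L)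
  have hinj := Finset.card_image_iff.1 (show ((minima ℓ).image (component L)).card = _ by omega)
  obtain ⟨y, hy, hyp⟩ := exists_minima ℓ p.1
  obtain ⟨z, hz, hzp⟩ := exists_minima ℓ p.2
  have hyz : y = z := hinj hy hz (by
    rw [h.fibre_le hρ hyp, h.fibre_le hρ hzp, component_edge hp])
  rw [← hyp, ← hzp, hyz]

open Classical in
/-- The excess of the number of entries of `as` over the number of elements, among the elements
of the fibre of `x` that are at most `x`. -/
noncomputable def height (ℓ : α → β) (as : List α) (x : α) : ℤ :=
  ∑ y with ℓ y = ℓ x ∧ y ≤ x, ((as.count y : ℤ) - 1)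

/-- `as` restricts to a parking function on each fibre of `ℓ`. -/
def IsParking (ℓ : α → β) (as : List α) : Prop :=
  ∀ x, (∃ y, ℓ y = ℓ x ∧ x < y) ∧ 0 ≤ height ℓ as x ∨
    (∀ y, ℓ y = ℓ x → y ≤ x) ∧ height ℓ as x = -1

open Classical in
lemma height_cons (ℓ : α → β) (a : α) (as : List α) (x : α) :
    height ℓ (a :: as) x = height ℓ as x + if ℓ a = ℓ x ∧ a ≤ x then 1 else 0 := by
  have : ∀ y, (((a :: as).count y : ℤ) - 1) = ((as.count y : ℤ) - 1) + if y = a then 1 else 0 := by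
    intro y
    rw [List.count_cons]
    by_cases h : y = a
    · subst h; simp
    · simp [h, Ne.symm h]
  simp only [height, this, Finset.sum_add_distrib, Finset.sum_filter]
  congr 1
  rw [Finset.sum_eq_single a (by grind) (by grind)]
  grind

section Split
variable {ℓ : α → β} {a b : α} {as : List α} {x : α}

lemma height_split_of_lt (h : ¬(ℓ x = ℓ a ∧ a ≤ x)) :
    height (split ℓ a b) as x = height ℓ (a :: as) x := by
  classical
  rw [height_cons, if_neg (by grind), add_zero]
  simp only [height, Finset.sum_filter, split_eq_iff]
  refine Finset.sum_congr rfl fun y _ => ?_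
  grind

lemma height_split_self (hab : a < b) :
    height ℓ (a :: as) a = height (split ℓ a b) as a + 1 := by
  classical
  rw [height_cons, if_pos (by grind)]
  simp only [height, Finset.sum_filter, split_eq_iff]
  congr 1
  refine Finset.sum_congr rfl fun y _ => ?_
  grind

lemma height_split_of_mem (hx : ℓ x = ℓ a) (hax : a < x) (hxb : x ≤ b) :
    height ℓ (a :: as) x = height ℓ (a :: as) a + height (split ℓ a b) as x := by
  classical
  rw [height_cons, height_cons, if_pos (by grind), if_pos (by grind), add_right_comm]
  simp only [height, Finset.sum_filter, split_eq_iff, ← Finset.sum_add_distrib]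
  congr 1
  refine Finset.sum_congr rfl fun y _ => ?_
  grind

lemma height_split_of_gt (hab : a < b) (hl : ℓ a = ℓ b) (hx : ℓ x = ℓ a) (hbx : b < x) :
    height ℓ (a :: as) x = height (split ℓ a b) as x + height (split ℓ a b) as b + 1 := by
  classical
  rw [height_cons, if_pos (by grind)]
  simp only [height, Finset.sum_filter, split_eq_iff, ← Finset.sum_add_distrib]
  congr 1
  refine Finset.sum_congr rfl fun y _ => ?_
  grind

lemma IsParking.height_split_right (h : IsParking (split ℓ a b) as) (hab : a < b)
    (hl : ℓ a = ℓ b) : height (split ℓ a b) as b = -1 := by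
  rcases h b with ⟨⟨y, hy, hby⟩, -⟩ | ⟨-, h⟩
  · rw [split_eq_iff] at hy
    grind
  · exact h

lemma IsParking.neg_one_le {ℓ : α → β} (h : IsParking ℓ as) (x : α) : -1 ≤ height ℓ as x := by
  rcases h x with ⟨-, h⟩ | ⟨-, h⟩ <;> omega

lemma IsParking.split_nonneg (h : IsParking (split ℓ a b) as) (hl : ℓ a = ℓ b)
    (hx : ℓ x = ℓ a) (hax : a < x) (hxb : x < b) : 0 ≤ height (split ℓ a b) as x := by
  rcases h x with ⟨-, h⟩ | ⟨hm, h⟩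
  · exact h
  · have := hm b (by rw [split_eq_iff]; grind)
    grind

lemma IsParking.of_split (h : IsParking (split ℓ a b) as) (hab : a < b) (hl : ℓ a = ℓ b) :
    IsParking ℓ (a :: as) := by
  have hb := h.height_split_right hab hl
  have ha := height_split_self (ℓ := ℓ) (as := as) hab
  have ha1 := h.neg_one_le a
  intro x
  by_cases hx : ℓ x = ℓ a ∧ a ≤ x
  · obtain ⟨hx, hax⟩ := hx
    rcases eq_or_lt_of_le hax with rfl | hax
    · left
      exact ⟨⟨b, hl.symm, hab⟩, by omega⟩
    rcases lt_trichotomy x b with hxb | rfl | hxb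
    · left
      have := h.split_nonneg hl hx hax hxb
      have := height_split_of_mem (as := as) hx hax hxb.le
      exact ⟨⟨b, by grind, hxb⟩, by omega⟩
    · have := height_split_of_mem (as := as) hx hax le_rfl
      rcases h a with ⟨⟨y, hy, hay⟩, h2⟩ | ⟨h1, h2⟩
      · rw [split_eq_iff] at hy
        left
        exact ⟨⟨y, by grind, by grind⟩, by omega⟩
      · right
        refine ⟨fun y hy => ?_, by omega⟩
        have := h1 y
        rw [split_eq_iff] at this
        grind
    · have := height_split_of_gt (as := as) hab hl hx hxb
      have e : height ℓ (a :: as) x = height (split ℓ a b) as x := by omega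
      rw [e]
      have := h x
      simp only [split_eq_iff] at this
      grind
  · rw [← height_split_of_lt (b := b) hx]
    have := h x
    simp only [split_eq_iff] at this
    rcases this with ⟨⟨y, h1, h2⟩, h3⟩ | ⟨h1, h2⟩
    · exact Or.inl ⟨⟨y, h1.1, h2⟩, h3⟩
    · refine Or.inr ⟨fun y hy => ?_, h2⟩
      have := h1 a
      grind

/-- The right end `b` of the first transposition is the first element after `a` where the
height is smaller than at `a`. -/
lemma IsParking.height_lt_of_split (h : IsParking (split ℓ a b) as) (hab : a < b)
    (hl : ℓ a = ℓ b) : height ℓ (a :: as) b < height ℓ (a :: as) a := by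
  have := height_split_of_mem (as := as) hl.symm hab le_rfl
  have := h.height_split_right hab hl
  omega

lemma IsParking.le_height_of_split (h : IsParking (split ℓ a b) as)
    (hl : ℓ a = ℓ b) (hx : ℓ x = ℓ a) (hax : a < x) (hxb : x < b) :
    height ℓ (a :: as) a ≤ height ℓ (a :: as) x := by
  have := height_split_of_mem (as := as) hx hax hxb.le
  have := h.split_nonneg hl hx hax hxb
  omega

lemma exists_height_eq_pred {z : α} (hz : ℓ z = ℓ x) (hzx : z < x) :
    ∃ p, ℓ p = ℓ x ∧ p < x ∧ z ≤ p ∧ height ℓ as x = height ℓ as p + as.count x - 1 := by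
  classical
  obtain ⟨p, hp, hmax⟩ := Finset.exists_max_image ({y | ℓ y = ℓ x ∧ y < x} : Finset α) id
    ⟨z, by simp [hz, hzx]⟩
  simp only [Finset.mem_filter, Finset.mem_univ, true_and, id] at hp hmax
  refine ⟨p, hp.1, hp.2, hmax z ⟨hz, hzx⟩, ?_⟩
  have : ({y | ℓ y = ℓ x ∧ y ≤ x} : Finset α) =
      insert x ({y | ℓ y = ℓ p ∧ y ≤ p} : Finset α) := by
    ext y
    simp only [Finset.mem_filter, Finset.mem_univ, true_and, Finset.mem_insert]
    grind
  rw [height, this, Finset.sum_insert (by simp [hp.2]), height]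
  ring

lemma height_eq_of_minimum (h : ∀ z, ℓ z = ℓ x → x ≤ z) :
    height ℓ as x = as.count x - 1 := by
  classical
  have : ({y | ℓ y = ℓ x ∧ y ≤ x} : Finset α) = {x} := by
    ext y
    simp only [Finset.mem_filter, Finset.mem_univ, true_and, Finset.mem_singleton]
    grind
  rw [height, this, Finset.sum_singleton]

lemma IsParking.exists_gt_of_mem (h : IsParking ℓ as) (hx : x ∈ as) :
    ∃ y, ℓ y = ℓ x ∧ x < y := by
  rcases h x with ⟨h, -⟩ | ⟨hmax, h⟩
  · exact h
  have hc : 0 < as.count x := List.count_pos_iff.2 hx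
  by_cases hz : ∃ z, ℓ z = ℓ x ∧ z < x
  · obtain ⟨z, hz, hzx⟩ := hz
    obtain ⟨p, hp, hpx, -, hh⟩ := exists_height_eq_pred (as := as) hz hzx
    rcases ‹IsParking ℓ as› p with ⟨-, h1⟩ | ⟨h1, -⟩
    · omega
    · have := h1 x hp.symm
      grind
  · have := height_eq_of_minimum (as := as) (ℓ := ℓ) (x := x) (by grind)
    omega

lemma IsParking.exists_split (h : IsParking ℓ (a :: as)) :
    ∃ b, a < b ∧ ℓ a = ℓ b ∧ IsParking (MinFact.split ℓ a b) as := by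
  classical
  obtain ⟨y, hy, hay⟩ := h.exists_gt_of_mem List.mem_cons_self
  have ha : 0 ≤ height ℓ (a :: as) a := by
    rcases h a with ⟨-, h⟩ | ⟨h, -⟩
    · exact h
    · have := h y hy
      grind
  obtain ⟨m, hm, hmax⟩ := Finset.exists_max_image ({y | ℓ y = ℓ a} : Finset α) id ⟨a, by simp⟩
  simp only [Finset.mem_filter, Finset.mem_univ, true_and, id] at hm hmax
  have hm1 : height ℓ (a :: as) m = -1 := by
    rcases h m with ⟨⟨z, hz, hmz⟩, -⟩ | ⟨-, h⟩
    · have := hmax z (by grind)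
      grind
    · exact h
  obtain ⟨b, hb, hmin⟩ := Finset.exists_min_image
    ({x | ℓ x = ℓ a ∧ a < x ∧ height ℓ (a :: as) x < height ℓ (a :: as) a} : Finset α) id
    ⟨m, by
      simp only [Finset.mem_filter, Finset.mem_univ, true_and]
      exact ⟨hm, lt_of_lt_of_le hay (hmax y hy), by omega⟩⟩
  simp only [Finset.mem_filter, Finset.mem_univ, true_and, id] at hb hmin
  obtain ⟨hlb, hab, hlt⟩ := hb
  have hbet : ∀ x, ℓ x = ℓ a → a ≤ x → x < b →
      height ℓ (a :: as) a ≤ height ℓ (a :: as) x := by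
    intro x hx hax hxb
    rcases eq_or_lt_of_le hax with rfl | hax
    · exact le_rfl
    by_contra hcon
    have := hmin x ⟨hx, hax, by omega⟩
    grind
  have hbeq : height ℓ (a :: as) b = height ℓ (a :: as) a - 1 := by
    obtain ⟨p, hp, hpb, hap, hh⟩ := exists_height_eq_pred (as := a :: as) hlb.symm hab
    have := hbet p (by grind) hap hpb
    omega
  have hself := height_split_self (ℓ := ℓ) (as := as) hab
  have hsb := height_split_of_mem (as := as) hlb hab le_rfl
  refine ⟨b, hab, hlb.symm, fun x => ?_⟩
  simp only [split_eq_iff]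
  by_cases hx : ℓ x = ℓ a ∧ a ≤ x
  · obtain ⟨hx, hax⟩ := hx
    rcases eq_or_lt_of_le hax with rfl | hax
    · rcases h b with ⟨⟨z, hz, hbz⟩, h2⟩ | ⟨h1, h2⟩
      · exact Or.inl ⟨⟨z, by grind, by grind⟩, by omega⟩
      · exact Or.inr ⟨by grind, by omega⟩
    rcases lt_trichotomy x b with hxb | rfl | hxb
    · have := height_split_of_mem (as := as) hx hax hxb.le
      have := hbet x hx hax.le hxb
      exact Or.inl ⟨⟨b, by grind, hxb⟩, by omega⟩
    · exact Or.inr ⟨by grind, by omega⟩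
    · have := height_split_of_gt (as := as) hab hlb.symm hx hxb
      have e : height (MinFact.split ℓ a b) as x = height ℓ (a :: as) x := by omega
      rw [e]
      have := h x
      grind
  · rw [height_split_of_lt hx]
    rcases h x with ⟨⟨z, h1, h2⟩, h3⟩ | ⟨h1, h2⟩
    · left
      refine ⟨?_, h3⟩
      by_cases hxa : ℓ x = ℓ a
      · exact ⟨a, by grind, by grind⟩
      · exact ⟨z, by grind, h2⟩
    · right
      exact ⟨by grind, h2⟩

end Split

theorem isParking_of_prodSwaps {σ : Perm α} {ℓ : α → β} {L : List (α × α)}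
    (h : IsCyclicSucc σ ℓ) (hlt : ∀ p ∈ L, p.1 < p.2) (hL : prodSwaps L = σ)
    (hc : L.length + (minima ℓ).card = Fintype.card α) : IsParking ℓ (L.map Prod.fst) := by
  induction L generalizing β σ with
  | nil =>
    subst hL
    intro x
    right
    have hx : ∀ y, ℓ y = ℓ x → y = x := by
      intro y hy
      have := h x
      simp only [prodSwaps, List.map_nil, List.reverse_nil, List.prod_nil, Perm.coe_one, id] at this
      grind
    refine ⟨fun y hy => (hx y hy).le, ?_⟩
    rw [height_eq_of_minimum (fun y hy => (hx y hy).ge)]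
    simp
  | cons p L ih =>
    obtain ⟨a, b⟩ := p
    have hab : a < b := hlt (a, b) List.mem_cons_self
    have hl : ℓ a = ℓ b := fibre_eq_of_mem h hL hc (p := (a, b)) List.mem_cons_self
    refine (ih (h.split hab hl) (fun p hp => hlt p (List.mem_cons_of_mem _ hp))
      (prodSwaps_eq_of_cons hL) ?_).of_split hab hl
    rw [card_minima_split h hab hl]
    simp only [List.length_cons] at hc
    omega

theorem prodSwaps_injective {σ : Perm α} {ℓ : α → β} {L M : List (α × α)}
    (h : IsCyclicSucc σ ℓ) (hlt : ∀ p ∈ L, p.1 < p.2) (hL : prodSwaps L = σ)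
    (hc : L.length + (minima ℓ).card = Fintype.card α)
    (hlt' : ∀ p ∈ M, p.1 < p.2) (hM : prodSwaps M = σ)
    (hLM : L.map Prod.fst = M.map Prod.fst) : L = M := by
  induction L generalizing β σ M with
  | nil => exact (List.map_eq_nil_iff.1 hLM.symm).symm
  | cons p L ih =>
    obtain ⟨a, b⟩ := p
    match M with
    | [] => simp at hLM
    | (a', b') :: M =>
      obtain ⟨rfl, htail⟩ : a = a' ∧ L.map Prod.fst = M.map Prod.fst := by simpa using hLM
      have hlen : L.length = M.length := by simpa using congrArg List.length htail
      simp only [List.length_cons] at hc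
      have hab : a < b := hlt (a, b) List.mem_cons_self
      have hab' : a < b' := hlt' (a, b') List.mem_cons_self
      have hl : ℓ a = ℓ b := fibre_eq_of_mem h hL (by simpa) (p := (a, b)) List.mem_cons_self
      have hl' : ℓ a = ℓ b' :=
        fibre_eq_of_mem h hM (by simpa [← hlen]) (p := (a, b')) List.mem_cons_self
      have hc1 : L.length + (minima (split ℓ a b)).card = Fintype.card α := by
        rw [card_minima_split h hab hl]; omega
      have hc2 : M.length + (minima (split ℓ a b')).card = Fintype.card α := by
        rw [card_minima_split h hab' hl']; omega
      have hltL := fun p hp => hlt p (List.mem_cons_of_mem _ hp)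
      have hltM := fun p hp => hlt' p (List.mem_cons_of_mem _ hp)
      have hp1 := isParking_of_prodSwaps (h.split hab hl) hltL (prodSwaps_eq_of_cons hL) hc1
      have hp2 := isParking_of_prodSwaps (h.split hab' hl') hltM (prodSwaps_eq_of_cons hM) hc2
      rw [← htail] at hp2
      have hbb : b = b' := by
        rcases lt_trichotomy b b' with hlt | heq | hlt
        · have h1 := hp1.height_lt_of_split hab hl
          have h2 := hp2.le_height_of_split hl' hl.symm hab hlt
          omega
        · exact heq
        · have h1 := hp2.height_lt_of_split hab' hl'
          have h2 := hp1.le_height_of_split hl hl'.symm hab' hlt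
          omega
      subst hbb
      rw [ih (h.split hab hl) hltL (prodSwaps_eq_of_cons hL) hc1 hltM
        (prodSwaps_eq_of_cons hM) htail]

theorem exists_prodSwaps {σ : Perm α} {ℓ : α → β} {as : List α}
    (h : IsCyclicSucc σ ℓ) (has : IsParking ℓ as) :
    ∃ L : List (α × α), (∀ p ∈ L, p.1 < p.2) ∧ prodSwaps L = σ ∧ L.map Prod.fst = as := by
  induction as generalizing β σ with
  | nil =>
    refine ⟨[], by simp, ?_, rfl⟩
    ext x
    have hneg : ∀ x, height ℓ [] x ≤ 0 := fun x =>
      Finset.sum_nonpos fun y _ => by simp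
    have hx : ∀ x y, ℓ y = ℓ x → y ≤ x := by
      intro x
      rcases has x with ⟨-, h2⟩ | ⟨h1, -⟩
      · classical
        have : height ℓ [] x ≤ -1 := by
          have := Finset.sum_le_sum_of_subset_of_nonneg (f := fun _ : α => (1 : ℤ))
            (show {x} ⊆ ({y | ℓ y = ℓ x ∧ y ≤ x} : Finset α) by simp) (by simp)
          simp only [height, List.count_nil, Nat.cast_zero, zero_sub, Finset.sum_neg_distrib]
          simp only [Finset.sum_singleton] at this
          omega
        omega
      · exact h1
    have := (h x).1
    exact le_antisymm (hx _ _ this.symm) (hx _ _ this)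
  | cons a as ih =>
    obtain ⟨b, hab, hl, hb⟩ := has.exists_split
    obtain ⟨L, h1, h2, h3⟩ := ih (h.split hab hl) hb
    refine ⟨(a, b) :: L, by simpa [hab] using h1, ?_, by simp [h3]⟩
    rw [prodSwaps_cons, h2, mul_assoc, swap_mul_self, mul_one]

open Classical in
/-- The transposition of the two least elements occurs at most once, and it does exactly when
no entry equal to the least element precedes one equal to the second. -/
theorem count_bottom_pair {σ : Perm α} {ℓ : α → β} {L : List (α × α)}
    (h : IsCyclicSucc σ ℓ) (hlt : ∀ p ∈ L, p.1 < p.2) (hL : prodSwaps L = σ)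
    (hc : L.length + (minima ℓ).card = Fintype.card α) {o z : α} (hoz : o < z)
    (ho : ∀ x, o ≤ x) (hz : ∀ x, x ≠ o → z ≤ x) :
    L.count (o, z) = if ℓ o = ℓ z ∧ (L.map Prod.fst).Pairwise (fun x y => ¬(x = o ∧ y = z))
      then 1 else 0 := by
  induction L generalizing β σ with
  | nil =>
    have hpark := isParking_of_prodSwaps h hlt hL hc
    have hne : ℓ o ≠ ℓ z := by
      intro hl
      rcases hpark o with ⟨-, h2⟩ | ⟨h1, -⟩
      · rw [height_eq_of_minimum fun x _ => ho x] at h2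
        simp at h2
      · exact absurd hoz (not_lt.2 (h1 z hl.symm))
    simp [hne]
  | cons p L ih =>
    obtain ⟨a, b⟩ := p
    have hab : a < b := hlt (a, b) List.mem_cons_self
    have hl : ℓ a = ℓ b := fibre_eq_of_mem h hL hc (p := (a, b)) List.mem_cons_self
    have hc1 : L.length + (minima (split ℓ a b)).card = Fintype.card α := by
      rw [card_minima_split h hab hl]
      simp only [List.length_cons] at hc
      omega
    have hltL := fun p hp => hlt p (List.mem_cons_of_mem _ hp)
    have hpark := isParking_of_prodSwaps (h.split hab hl) hltL (prodSwaps_eq_of_cons hL) hc1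
    rw [List.count_cons, ih (h.split hab hl) hltL (prodSwaps_eq_of_cons hL) hc1]
    simp only [List.map_cons, List.pairwise_cons, split_eq_iff]
    by_cases ha : a = o
    · subst ha
      have hbz : z ≤ b := hz b hab.ne'
      by_cases hlz : ℓ a = ℓ z
      · have hzmem : z ∈ L.map Prod.fst ↔ z ≠ b := by
          have hheight := height_eq_of_minimum (ℓ := split ℓ a b) (x := z)
            (as := L.map Prod.fst) (by
              intro y hy
              rw [split_eq_iff] at hy
              exact hz y (by grind))
          rw [← List.count_pos_iff]
          rcases hpark z with ⟨⟨y, hy, hzy⟩, h2⟩ | ⟨h1, h2⟩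
          · rw [split_eq_iff] at hy
            have : z ≠ b := by grind
            simp only [this, ne_eq, not_false_eq_true, iff_true]
            omega
          · have : z = b := by
              have := h1 b (by rw [split_eq_iff]; grind)
              grind
            simp only [this, ne_eq, not_true_eq_false, iff_false]
            subst this
            omega
        have hpw : z ∉ L.map Prod.fst →
            (L.map Prod.fst).Pairwise (fun x y => ¬(x = a ∧ y = z)) := by
          intro hn
          refine List.pairwise_of_forall_mem_list fun x _ y hy => ?_
          rintro ⟨-, rfl⟩
          exact hn hy
        by_cases hzb : z = b
        · subst hzb
          have hn : z ∉ L.map Prod.fst := by simpa using hzmem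
          have hp := hpw hn
          have : ∀ y ∈ L.map Prod.fst, ¬(a = a ∧ y = z) := by
            rintro y hy ⟨-, rfl⟩
            exact hn hy
          grind
        · have : ¬ ∀ y ∈ L.map Prod.fst, ¬(a = a ∧ y = z) := fun hcon =>
            hcon z (hzmem.2 hzb) ⟨rfl, rfl⟩
          have hbz : ((a, b) == (a, z)) = false := by simp [Ne.symm hzb]
          grind
      · have : ((a, b) == (a, z)) = false := by
          simp only [beq_eq_false_iff_ne, ne_eq, Prod.mk.injEq, true_and]
          rintro rfl
          exact hlz hl
        simp [hlz, this]
    · have h1 : ((a, b) == (o, z)) = false := by simp [ha]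
      have h2 := hz a ha
      have h3 : ∀ y ∈ L.map Prod.fst, ¬(a = o ∧ y = z) := fun y _ h => ha h.1
      grind

end Bijection

lemma count_ofFn {γ : Type} [BEq γ] [LawfulBEq γ] [DecidableEq γ] {n : ℕ} (f : Fin n → γ)
    (y : γ) :
    (List.ofFn f).count y = (Finset.univ.filter fun k => f k = y).card := by
  induction n with
  | zero => simp
  | succ n ih =>
    rw [List.ofFn_succ, List.count_cons, ih, Fin.card_filter_univ_succ]
    by_cases h : f 0 = y <;> simp [h]

section Fin
variable {m : ℕ}

/-- The lesser of the two points moved by a transposition. -/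
def lo (τ : Perm (Fin (m + 2))) : Fin (m + 2) := τ.support.inf id

lemma lo_swap {a b : Fin (m + 2)} (h : a < b) : lo (swap a b) = a := by
  rw [lo, Perm.support_swap h.ne]
  simp [h.le]

lemma lo_lt_and_eq_swap {τ : Perm (Fin (m + 2))} (h : τ.IsSwap) :
    lo τ < τ (lo τ) ∧ τ = swap (lo τ) (τ (lo τ)) := by
  obtain ⟨x, y, hxy, rfl⟩ := h
  rcases lt_or_gt_of_ne hxy with h | h
  · rw [lo_swap h, swap_apply_left]
    exact ⟨h, rfl⟩
  · rw [swap_comm, lo_swap h, swap_apply_left]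
    exact ⟨h, rfl⟩

lemma isCyclicSucc_finRotate :
    IsCyclicSucc (finRotate (m + 2)) (fun _ : Fin (m + 2) => ()) := by
  intro x
  refine ⟨rfl, ?_⟩
  by_cases hx : x = Fin.last (m + 1)
  · subst hx
    right
    intro y _
    rw [finRotate_last]
    exact ⟨Fin.zero_le y, Fin.le_last y⟩
  · left
    have : (finRotate (m + 2) x : ℕ) = x + 1 := coe_finRotate_of_ne_last hx
    simp only [Fin.lt_def, Fin.le_def]
    refine ⟨by omega, fun y _ hy => by omega⟩

lemma card_minima_const : (minima (fun _ : Fin (m + 2) => ())).card = 1 := by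
  rw [Finset.card_eq_one]
  refine ⟨0, ?_⟩
  ext x
  simp only [minima, Finset.mem_filter, Finset.mem_univ, true_and, Finset.mem_singleton]
  constructor
  · intro h
    exact le_antisymm (h 0 trivial) (Fin.zero_le x)
  · rintro rfl y _
    exact Fin.zero_le y

lemma height_const {n : ℕ} (f : Fin n → Fin (m + 2)) (x : Fin (m + 2)) :
    height (fun _ : Fin (m + 2) => ()) (List.ofFn f) x =
      ((Finset.univ.filter fun k => f k ≤ x).card : ℤ) - (x + 1) := by
  classical
  have h1 : (Finset.univ.filter fun k => f k ≤ x).card =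
      ∑ y ∈ Finset.Iic x, (Finset.univ.filter fun k => f k = y).card := by
    rw [Finset.card_eq_sum_card_fiberwise (f := f) (t := Finset.Iic x)
      (fun k hk => by simpa using hk)]
    refine Finset.sum_congr rfl fun y hy => ?_
    rw [Finset.filter_filter]
    congr 1
    ext k
    simp only [Finset.mem_filter, Finset.mem_univ, true_and, Finset.mem_Iic] at hy ⊢
    grind
  rw [height, Finset.sum_congr (s₂ := Finset.Iic x) (by ext y; simp) fun _ _ => rfl,
    Finset.sum_sub_distrib, h1]
  simp [count_ofFn]

/-- `f` is a parking function in the generalized sense that its nondecreasing rearrangement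
`c₀ ≤ c₁ ≤ ⋯` satisfies `c_s < a + s`. -/
def IsShiftedParking {ι : Type} [Fintype ι] (a : ℕ) (f : ι → ℕ) : Prop :=
  ∀ y < a + Fintype.card ι, y < a + (Finset.univ.filter fun k => f k < y).card

lemma IsShiftedParking.lt {ι : Type} [Fintype ι] {a : ℕ} {f : ι → ℕ} (h : IsShiftedParking a f)
    (k : ι) : f k < a + Fintype.card ι := by
  have : 0 < Fintype.card ι := Fintype.card_pos_iff.2 ⟨k⟩
  have h1 := h (a + Fintype.card ι - 1) (by omega)
  have h2 : (Finset.univ.filter fun k => f k < a + Fintype.card ι - 1) = Finset.univ := by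
    refine Finset.eq_univ_of_card _ (le_antisymm (Finset.card_le_univ _) (by omega))
  have h3 : k ∈ Finset.univ.filter fun k => f k < a + Fintype.card ι - 1 := by simp [h2]
  simp only [Finset.mem_filter, Finset.mem_univ, true_and] at h3
  omega

lemma isParking_const_iff (f : Fin (m + 1) → Fin (m + 2)) :
    IsParking (fun _ : Fin (m + 2) => ()) (List.ofFn f) ↔
      IsShiftedParking 1 (fun k => (f k : ℕ)) := by
  simp only [IsParking, IsShiftedParking, height_const, Fintype.card_fin]
  constructor
  · intro h y hy
    rcases Nat.eq_zero_or_pos y with rfl | hpos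
    · omega
    have := h ⟨y - 1, by omega⟩
    have e : (Finset.univ.filter fun k => f k ≤ ⟨y - 1, by omega⟩) =
        Finset.univ.filter fun k => (f k : ℕ) < y := by
      ext k
      simp only [Finset.mem_filter, Finset.mem_univ, true_and, Fin.le_def]
      omega
    rw [e] at this
    rcases this with ⟨-, h2⟩ | ⟨h1, -⟩
    · simp only at h2
      omega
    · have := h1 (Fin.last _) trivial
      simp only [Fin.le_def, Fin.val_last] at this
      omega
  · intro h x
    have e : (Finset.univ.filter fun k => f k ≤ x) =
        Finset.univ.filter fun k => (f k : ℕ) < x + 1 := by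
      ext k
      simp only [Finset.mem_filter, Finset.mem_univ, true_and, Fin.le_def]
      omega
    rw [e]
    by_cases hx : x = Fin.last (m + 1)
    · subst hx
      right
      refine ⟨fun y _ => Fin.le_last y, ?_⟩
      have : (Finset.univ.filter fun k => (f k : ℕ) < (Fin.last (m + 1) : ℕ) + 1) =
          Finset.univ := by
        ext k
        have := (f k).2
        simp only [Finset.mem_filter, Finset.mem_univ, true_and, Fin.val_last, iff_true]
        omega
      rw [this]
      simp
    · left
      have hx' : (x : ℕ) < m + 1 := Fin.val_lt_last hx
      refine ⟨⟨Fin.last _, trivial, by simpa [Fin.lt_def] using hx'⟩, ?_⟩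
      have := h (x + 1) (by omega)
      omega

/-- The transpositions of `F` written as increasing pairs. -/
def pairs {n : ℕ} (F : Fin n → Perm (Fin (m + 2))) : Fin n → Fin (m + 2) × Fin (m + 2) :=
  fun k => (lo (F k), F k (lo (F k)))

lemma pairs_injective {n : ℕ} {F G : Fin n → Perm (Fin (m + 2))} (hF : ∀ k, (F k).IsSwap)
    (hG : ∀ k, (G k).IsSwap) (h : pairs F = pairs G) : F = G := by
  funext k
  have hk := congrFun h k
  simp only [pairs, Prod.mk.injEq] at hk
  rw [(lo_lt_and_eq_swap (hF k)).2, (lo_lt_and_eq_swap (hG k)).2, hk.2, hk.1]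

lemma prodSwaps_pairs {n : ℕ} {F : Fin n → Perm (Fin (m + 2))} (hF : ∀ k, (F k).IsSwap) :
    prodSwaps (List.ofFn (pairs F)) = (List.ofFn F).reverse.prod := by
  rw [prodSwaps, List.map_ofFn]
  congr 3
  funext k
  exact (lo_lt_and_eq_swap (hF k)).2.symm

lemma pairs_lt {n : ℕ} {F : Fin n → Perm (Fin (m + 2))} (hF : ∀ k, (F k).IsSwap) :
    ∀ p ∈ List.ofFn (pairs F), p.1 < p.2 :=
  List.forall_mem_ofFn_iff.2 fun k => (lo_lt_and_eq_swap (hF k)).1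

lemma map_fst_pairs {n : ℕ} (F : Fin n → Perm (Fin (m + 2))) :
    (List.ofFn (pairs F)).map Prod.fst = List.ofFn fun k => lo (F k) := by
  rw [List.map_ofFn]
  rfl

lemma length_pairs_add_card_minima (F : Fin (m + 1) → Perm (Fin (m + 2))) :
    (List.ofFn (pairs F)).length + (minima (fun _ : Fin (m + 2) => ())).card =
      Fintype.card (Fin (m + 2)) := by
  rw [card_minima_const]
  simp

lemma apply_ne_iff {τ : Perm (Fin (m + 2))} (h : τ.IsSwap) (x : Fin (m + 2)) :
    τ x ≠ x ↔ lo τ = x ∨ τ (lo τ) = x := by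
  obtain ⟨h1, h2⟩ := lo_lt_and_eq_swap h
  generalize τ (lo τ) = b at *
  generalize lo τ = a at *
  subst h2
  rw [swap_apply_def]
  grind

lemma Tcount_zero {F : Fin (m + 1) → Perm (Fin (m + 2))} (hF : ∀ k, (F k).IsSwap) :
    Tcount (n := m + 2) F 0 = (Finset.univ.filter fun k => (lo (F k) : ℕ) = 0).card := by
  rw [Tcount]
  congr 1
  ext k
  simp only [Finset.mem_filter, Finset.mem_univ, true_and, apply_ne_iff (hF k)]
  have := (lo_lt_and_eq_swap (hF k)).1
  grind

open Classical in
lemma Tcount_one {F : Fin (m + 1) → Perm (Fin (m + 2))} (hF : IsMinFact (m + 2) F) :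
    Tcount (n := m + 2) F 1 = (Finset.univ.filter fun k => (lo (F k) : ℕ) = 1).card +
      if ∀ k l, k < l → ¬((lo (F k) : ℕ) = 0 ∧ (lo (F l) : ℕ) = 1) then 1 else 0 := by
  have hS : ∀ k, (F k).IsSwap := hF.1
  have hcount := count_bottom_pair isCyclicSucc_finRotate (pairs_lt hS)
    ((prodSwaps_pairs hS).trans hF.2) (length_pairs_add_card_minima F)
    (o := 0) (z := 1) (by simp) Fin.zero_le (fun x hx => by
      have := Fin.pos_iff_ne_zero.2 hx
      rw [Fin.le_def]
      exact this)
  simp only [count_ofFn, map_fst_pairs, List.pairwise_ofFn] at hcount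
  have hiff : ∀ k : Fin (m + 1), (lo (F k) : ℕ) = 1 ↔ lo (F k) = 1 := fun k => by
    rw [Fin.ext_iff, Fin.val_one]
  have hiff0 : ∀ k : Fin (m + 1), (lo (F k) : ℕ) = 0 ↔ lo (F k) = 0 := fun k => by
    rw [Fin.ext_iff, Fin.val_zero]
  simp only [true_and, ← hiff, ← hiff0] at hcount
  rw [← hcount, Tcount, ← Finset.card_union_of_disjoint]
  · congr 1
    ext k
    simp only [Finset.mem_filter, Finset.mem_univ, true_and, Finset.mem_union, pairs,
      Prod.mk.injEq]
    rw [hiff]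
    refine (apply_ne_iff (hS k) 1).trans ?_
    have h1 := (lo_lt_and_eq_swap (hS k)).1
    have : F k (lo (F k)) = 1 → lo (F k) = 0 := by
      intro h
      rw [h] at h1
      simp only [Fin.lt_def, Fin.ext_iff] at *
      simpa using h1
    grind
  · rw [Finset.disjoint_left]
    intro k h1 h2
    simp only [Finset.mem_filter, Finset.mem_univ, true_and, pairs, Prod.mk.injEq] at h1 h2
    rw [h2.1] at h1
    simp at h1

/-- The joint law of `T₁` and `T₂` in terms of parking functions. -/
def ParkingStat {n : ℕ} (i j : ℕ) (f : Fin n → ℕ) : Prop :=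
  (Finset.univ.filter fun k => f k = 0).card = i ∧
    open Classical in (Finset.univ.filter fun k => f k = 1).card +
      (if ∀ k l, k < l → ¬(f k = 0 ∧ f l = 1) then 1 else 0) = j

theorem card_minFact_eq (i j : ℕ) :
    Nat.card {F : Fin (m + 1) → Perm (Fin (m + 2)) //
      IsMinFact (m + 2) F ∧ Tcount (n := m + 2) F 0 = i ∧ Tcount (n := m + 2) F 1 = j} =
    Nat.card {f : Fin (m + 1) → ℕ // IsShiftedParking 1 f ∧ ParkingStat i j f} := by
  refine Nat.card_eq_of_bijective
    (fun F => ⟨fun k => (lo (F.1 k) : ℕ), ?_, ?_, ?_⟩) ⟨?_, ?_⟩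
  · obtain ⟨F, hF, -, -⟩ := F
    have hS : ∀ k, (F k).IsSwap := hF.1
    rw [← isParking_const_iff, ← map_fst_pairs]
    exact isParking_of_prodSwaps isCyclicSucc_finRotate (pairs_lt hS)
      ((prodSwaps_pairs hS).trans hF.2) (length_pairs_add_card_minima F)
  · exact (Tcount_zero F.2.1.1).symm.trans F.2.2.1
  · exact (Tcount_one F.2.1).symm.trans F.2.2.2
  · rintro ⟨F, hF, _, _⟩ ⟨G, hG, _, _⟩ h
    have hS : ∀ k, (F k).IsSwap := hF.1
    have hS' : ∀ k, (G k).IsSwap := hG.1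
    simp only [Subtype.mk.injEq, funext_iff, Fin.val_inj] at h
    have := prodSwaps_injective isCyclicSucc_finRotate (pairs_lt hS)
      ((prodSwaps_pairs hS).trans hF.2) (length_pairs_add_card_minima F) (pairs_lt hS')
      ((prodSwaps_pairs hS').trans hG.2) (by
        rw [map_fst_pairs, map_fst_pairs]
        exact congrArg _ (funext h))
    exact Subtype.ext (pairs_injective hS hS' (List.ofFn_injective this))
  · rintro ⟨f, hf, hi, hj⟩
    have hlt : ∀ k, f k < m + 2 := fun k => by
      have := hf.lt k
      simp only [Fintype.card_fin] at this
      omega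
    obtain ⟨L, h1, h2, h3⟩ := exists_prodSwaps isCyclicSucc_finRotate
      ((isParking_const_iff fun k => ⟨f k, hlt k⟩).2 hf)
    have hlen : L.length = m + 1 := by simpa using congrArg List.length h3
    obtain ⟨g, rfl⟩ : ∃ g : Fin (m + 1) → Fin (m + 2) × Fin (m + 2), List.ofFn g = L := by
      clear h3
      rw [← hlen]
      exact ⟨L.get, List.ofFn_get L⟩
    rw [List.forall_mem_ofFn_iff] at h1
    rw [List.map_ofFn, List.ofFn_inj] at h3
    have hlo : ∀ k, (lo (swap (g k).1 (g k).2) : ℕ) = f k := fun k => by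
      rw [lo_swap (h1 k)]
      exact congrArg Fin.val (congrFun h3 k)
    have hF : IsMinFact (m + 2) (fun k : Fin (m + 1) => swap (g k).1 (g k).2) := by
      refine ⟨fun k => ⟨_, _, (h1 k).ne, rfl⟩, ?_⟩
      rw [← h2, prodSwaps, List.map_ofFn]
      rfl
    refine ⟨⟨_, hF, ?_, ?_⟩, Subtype.ext (funext hlo)⟩
    · rw [Tcount_zero hF.1]
      simpa only [hlo] using hi
    · rw [Tcount_one hF]
      simpa only [hlo] using hj

end Fin

section Counting

lemma card_filter_eq_add {ι : Type} [Fintype ι] [DecidableEq ι] (S : Finset ι) (P : ι → Prop)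
    [DecidablePred P] :
    (Finset.univ.filter P).card =
      (S.filter P).card + (Finset.univ.filter fun k : {k // k ∉ S} => P k).card := by
  simp only [Finset.card_filter]
  rw [← Finset.sum_add_sum_compl S,
    Finset.sum_subtype Sᶜ (p := fun k => k ∉ S) fun x => Finset.mem_compl]

lemma isShiftedParking_iff_compl {ι : Type} [Fintype ι] [DecidableEq ι] {a v : ℕ} {S : Finset ι}
    {f : ι → ℕ} (hfv : ∀ k ∈ S, f k < v) (hfv' : ∀ k ∉ S, v ≤ f k) (hv : 0 < v)
    (hS : ∀ y < v, y < a + (S.filter fun k => f k < y).card) :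
    IsShiftedParking a f ↔
      IsShiftedParking (a + S.card - v) fun k : {k // k ∉ S} => f k - v := by
  have hcard : Fintype.card {k // k ∉ S} = Fintype.card ι - S.card := by
    rw [Fintype.card_subtype_compl]; simp
  have hle : S.card ≤ Fintype.card ι := Finset.card_le_univ S
  have hav : v ≤ a + S.card := by
    have := hS (v - 1) (by omega)
    have := Finset.card_filter_le S fun k => f k < v - 1
    omega
  have hlow : ∀ y < v, y < a + (Finset.univ.filter fun k => f k < y).card := by
    intro y hy
    rw [card_filter_eq_add S]
    have := hS y hy
    omega
  have hhigh : ∀ y, (Finset.univ.filter fun k => f k < y + v).card =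
      S.card + (Finset.univ.filter fun k : {k // k ∉ S} => f k - v < y).card := by
    intro y
    rw [card_filter_eq_add S, Finset.filter_true_of_mem fun k hk => by have := hfv k hk; omega]
    congr 2
    ext k
    have := hfv' k k.2
    simp only [Finset.mem_filter, Finset.mem_univ, true_and]
    omega
  constructor
  · intro h y hy
    have := h (y + v) (by omega)
    rw [hhigh] at this
    beta_reduce
    omega
  · intro h y hy
    rcases lt_or_ge y v with hyv | hyv
    · exact hlow y hyv
    · obtain ⟨z, rfl⟩ := Nat.exists_eq_add_of_le' hyv
      rw [hhigh]
      have := h z (by omega)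
      beta_reduce at this
      omega

lemma card_isShiftedParking_fibre {ι : Type} [Fintype ι] [DecidableEq ι] {a v : ℕ}
    {S : Finset ι} {p : ι → ℕ} (hp : ∀ k ∈ S, p k < v) (hv : 0 < v)
    (hS : ∀ y < v, y < a + (S.filter fun k => p k < y).card) :
    Nat.card {f : ι → ℕ // IsShiftedParking a f ∧ (∀ k ∈ S, f k = p k) ∧ ∀ k ∉ S, v ≤ f k} =
      Nat.card {g : {k // k ∉ S} → ℕ // IsShiftedParking (a + S.card - v) g} := by
  have key : ∀ f : ι → ℕ, (∀ k ∈ S, f k = p k) → (∀ k ∉ S, v ≤ f k) →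
      (IsShiftedParking a f ↔
        IsShiftedParking (a + S.card - v) fun k : {k // k ∉ S} => f k - v) := by
    intro f h1 h2
    refine isShiftedParking_iff_compl (fun k hk => h1 k hk ▸ hp k hk) h2 hv fun y hy => ?_
    rw [Finset.filter_congr fun k hk => by rw [h1 k hk]]
    exact hS y hy
  refine Nat.card_congr
    { toFun := fun f => ⟨fun k => f.1 k - v, (key f.1 f.2.2.1 f.2.2.2).1 f.2.1⟩
      invFun := fun g => ⟨fun k => if h : k ∈ S then p k else g.1 ⟨k, h⟩ + v, ?_, ?_, ?_⟩
      left_inv := ?_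
      right_inv := ?_ }
  · rw [key]
    · convert g.2 using 2 with k
      simp [k.2]
    · intro k hk
      simp [hk]
    · intro k hk
      simp [hk]
  · intro k hk
    simp [hk]
  · intro k hk
    simp [hk]
  · rintro ⟨f, h1, h2, h3⟩
    ext k
    by_cases hk : k ∈ S
    · simp [hk, h2 k hk]
    · simp [hk, h3 k hk]
  · rintro ⟨g, hg⟩
    ext k
    simp [k.2]

instance {ι : Type} [Fintype ι] (a : ℕ) : Finite {f : ι → ℕ // IsShiftedParking a f} :=
  Finite.of_injective
    (β := ι → Fin (a + Fintype.card ι)) (fun f k => ⟨f.1 k, f.2.lt k⟩) fun f g h => by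
      ext k
      exact congrArg Fin.val (congrFun h k)

lemma card_eq_sum_fibre {X Y : Type} [Fintype Y] (P : X → Prop) [Finite {x // P x}]
    (φ : X → Y) : Nat.card {x // P x} = ∑ y, Nat.card {x // P x ∧ φ x = y} := by
  rw [Nat.card_congr (Equiv.sigmaFiberEquiv fun x : {x // P x} => φ x.1).symm, Nat.card_sigma]
  exact Finset.sum_congr rfl fun y _ =>
    Nat.card_congr (Equiv.subtypeSubtypeEquivSubtypeInter P fun x => φ x = y)

/-- The number of shifted parking functions on `m` positions. -/
noncomputable def parkingCount (a m : ℕ) : ℝ :=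
  if a + m = 0 then 1 else a * ((a + m : ℕ) : ℝ) ^ m / (a + m : ℕ)

lemma sum_mul_choose_mul_pow (m : ℕ) (t : ℝ) :
    ∑ k ∈ Finset.range (m + 1), (m.choose k : ℝ) * (k * t ^ (m - k)) = m * (t + 1) ^ (m - 1) := by
  rcases m with _ | m
  · simp
  rw [Finset.sum_range_succ']
  have h : (t + 1) ^ m = ∑ k ∈ Finset.range (m + 1), t ^ (m - k) * (m.choose k : ℝ) := by
    rw [add_comm t 1, add_pow]
    simp
  simp only [Nat.add_sub_cancel, h, Finset.mul_sum, Nat.cast_zero, zero_mul, mul_zero, add_zero]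
  refine Finset.sum_congr rfl fun k _ => ?_
  have h2 : ((m + 1 : ℕ) : ℝ) * m.choose k = (m + 1).choose (k + 1) * (k + 1 : ℕ) := by
    exact_mod_cast Nat.add_one_mul_choose_eq m k
  rw [Nat.add_sub_add_right]
  linear_combination (-t ^ (m - k)) * h2

lemma sum_choose_mul_parkingCount (a m : ℕ) :
    ∑ k ∈ Finset.range (m + 1), (m.choose k : ℝ) * parkingCount (a + k) (m - k) =
      parkingCount (a + 1) m := by
  rcases Nat.eq_zero_or_pos (a + m) with h0 | hpos
  · obtain ⟨rfl, rfl⟩ : a = 0 ∧ m = 0 := by omega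
    simp [parkingCount]
  set t : ℝ := ((a + m : ℕ) : ℝ) with ht
  have ht0 : 0 < t := by positivity
  have hterm : ∀ k ∈ Finset.range (m + 1), (m.choose k : ℝ) * parkingCount (a + k) (m - k) =
      (a * (t ^ (m - k) * m.choose k) + m.choose k * (k * t ^ (m - k))) / t := by
    intro k hk
    have hk : k ≤ m := by simpa [Nat.lt_succ_iff] using hk
    have : a + k + (m - k) = a + m := by omega
    rw [parkingCount, this, if_neg (by omega), ← ht]
    push_cast
    field_simp
  have h : (t + 1) ^ m = ∑ k ∈ Finset.range (m + 1), t ^ (m - k) * (m.choose k : ℝ) := by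
    rw [add_comm t 1, add_pow]
    simp
  rw [Finset.sum_congr rfl hterm, ← Finset.sum_div, Finset.sum_add_distrib, ← Finset.mul_sum,
    ← h, sum_mul_choose_mul_pow, parkingCount, if_neg (by omega)]
  have ht1 : ((a + 1 + m : ℕ) : ℝ) = t + 1 := by rw [ht]; push_cast; ring
  rw [ht1]
  have hta : t = a + m := by rw [ht]; push_cast; ring
  push_cast
  have : t + 1 ≠ 0 := by positivity
  rw [div_eq_div_iff ht0.ne' this]
  rcases m with _ | m
  · simp at hta ⊢
    rw [hta]; ring
  · rw [Nat.add_sub_cancel, pow_succ]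
    push_cast at hta ⊢
    have hm : (m : ℝ) = t - a - 1 := by linarith
    rw [hm]
    ring

theorem card_isShiftedParking {ι : Type} [Fintype ι] (a : ℕ) :
    (Nat.card {f : ι → ℕ // IsShiftedParking a f} : ℝ) = parkingCount a (Fintype.card ι) := by
  classical
  induction h : a + Fintype.card ι generalizing a ι with
  | zero =>
    obtain ⟨rfl, h0⟩ : a = 0 ∧ Fintype.card ι = 0 := by omega
    have := Fintype.card_eq_zero_iff.1 h0
    have : Nonempty {f : ι → ℕ // IsShiftedParking 0 f} :=
      ⟨⟨isEmptyElim, fun y hy => by omega⟩⟩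
    rw [parkingCount, if_pos (by omega), Nat.card_eq_one_iff_unique.2 ⟨inferInstance, this⟩]
    simp
  | succ N ih =>
    rcases a with _ | a
    · have : IsEmpty {f : ι → ℕ // IsShiftedParking 0 f} := ⟨fun f => by
        have := f.2 0 (by omega)
        simp at this⟩
      rw [parkingCount, if_neg (by omega)]
      simp
    rw [card_eq_sum_fibre _ fun f : ι → ℕ => Finset.univ.filter fun k => f k = 0, Nat.cast_sum]
    have hS : ∀ S : Finset ι, (Nat.card {f : ι → ℕ // IsShiftedParking (a + 1) f ∧
        (Finset.univ.filter fun k => f k = 0) = S} : ℝ) =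
          parkingCount (a + S.card) (Fintype.card ι - S.card) := by
      intro S
      have hcard : Fintype.card {k // k ∉ S} = Fintype.card ι - S.card := by
        rw [Fintype.card_subtype_compl]; simp
      have hle : S.card ≤ Fintype.card ι := Finset.card_le_univ S
      rw [← hcard, ← ih (a + S.card) (by omega)]
      have := card_isShiftedParking_fibre (a := a + 1) (v := 1) (S := S) (p := fun _ => 0)
        (by simp) one_pos (by intro y hy; omega)
      rw [show a + 1 + S.card - 1 = a + S.card by omega] at this
      rw [← this]
      congr 1
      refine Nat.card_congr (Equiv.subtypeEquivRight fun f => and_congr_right fun _ => ?_)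
      constructor
      · rintro rfl
        simp [Nat.one_le_iff_ne_zero]
      · rintro ⟨h1, h2⟩
        ext k
        simp only [Finset.mem_filter, Finset.mem_univ, true_and]
        grind
    simp only [hS]
    rw [← Finset.powerset_univ,
      Finset.sum_powerset_apply_card (fun k => parkingCount (a + k) (Fintype.card ι - k)),
      Finset.card_univ, ← sum_choose_mul_parkingCount]
    simp only [nsmul_eq_mul]

/-- A set has exactly one subset of each size consisting of its largest elements. -/
lemma card_upper_subsets {ι : Type} [Fintype ι] [LinearOrder ι] {i : ℕ} {C : Finset ι}
    (hi : i ≤ C.card) : (Finset.univ.filter fun A : Finset ι =>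
      (A ⊆ C ∧ A.card = i) ∧ ∀ k ∈ A, ∀ l ∈ C \ A, ¬k < l).card = 1 := by
  rw [Finset.card_eq_one]
  have hex : ∃ A ⊆ C, A.card = i ∧ ∀ k ∈ A, ∀ l ∈ C \ A, ¬k < l := by
    induction i with
    | zero => exact ⟨∅, by simp⟩
    | succ i ih =>
      obtain ⟨A, hA, hAi, hAu⟩ := ih (by omega)
      have hne : (C \ A).Nonempty := by
        rw [← Finset.card_pos, Finset.card_sdiff_of_subset hA]
        omega
      obtain ⟨x, hx, hmax⟩ := Finset.exists_max_image _ id hne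
      have hx' := Finset.mem_sdiff.1 hx
      refine ⟨insert x A, Finset.insert_subset hx'.1 hA, ?_, ?_⟩
      · rw [Finset.card_insert_of_notMem hx'.2, hAi]
      · intro k hk l hl
        have hl' : l ∈ C \ A := by
          simp only [Finset.mem_sdiff, Finset.mem_insert] at hl ⊢
          tauto
        rcases Finset.mem_insert.1 hk with rfl | hk
        · exact not_lt.2 (hmax l hl')
        · exact hAu k hk l hl'
  obtain ⟨A, hA, hAi, hAu⟩ := hex
  refine ⟨A, ?_⟩
  ext B
  simp only [Finset.mem_filter, Finset.mem_univ, true_and, Finset.mem_singleton]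
  constructor
  · rintro ⟨⟨hB, hBi⟩, hBu⟩
    by_contra hne
    have h1 : ∃ x ∈ A, x ∉ B := by
      by_contra! hcon
      exact hne (Finset.eq_of_subset_of_card_le hcon (by omega)).symm
    have h2 : ∃ x ∈ B, x ∉ A := by
      by_contra! hcon
      exact hne (Finset.eq_of_subset_of_card_le hcon (by omega))
    obtain ⟨x, hxA, hxB⟩ := h1
    obtain ⟨y, hyB, hyA⟩ := h2
    have h3 := hAu x hxA y (Finset.mem_sdiff.2 ⟨hB hyB, hyA⟩)
    have h4 := hBu y hyB x (Finset.mem_sdiff.2 ⟨hA hxA, hxB⟩)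
    exact hxB (le_antisymm (not_lt.1 h4) (not_lt.1 h3) ▸ hyB)
  · rintro rfl
    exact ⟨⟨hA, hAi⟩, hAu⟩

end Counting

section Limit

open Classical in
lemma card_parking_fibre {n i j : ℕ} (hi : 1 ≤ i) (C A : Finset (Fin n)) :
    (Nat.card {f : Fin n → ℕ // (IsShiftedParking 1 f ∧ ParkingStat i j f) ∧
      ((Finset.univ.filter fun k => f k < 2), (Finset.univ.filter fun k => f k = 0)) = (C, A)} : ℝ)
    = if (A ⊆ C ∧ A.card = i) ∧
        C.card - i + (if ∀ k ∈ A, ∀ l ∈ C \ A, ¬k < l then 1 else 0) = j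
      then parkingCount (C.card - 1) (n - C.card) else 0 := by
  have hzero : ∀ f : Fin n → ℕ,
      (A ⊆ C ∧ (∀ k ∈ C, f k = if k ∈ A then 0 else 1) ∧ ∀ k ∉ C, 2 ≤ f k) →
      ∀ k, f k = 0 ↔ k ∈ A := by
    rintro f ⟨h1, h2, h3⟩ k
    by_cases hC : k ∈ C
    · simp [h2 k hC]
    · have := h3 k hC
      have hA : k ∉ A := fun hk => hC (h1 hk)
      simp only [hA, iff_false]
      omega
  have hfib : ∀ f : Fin n → ℕ,
      ((Finset.univ.filter fun k => f k < 2), (Finset.univ.filter fun k => f k = 0)) = (C, A) ↔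
      A ⊆ C ∧ (∀ k ∈ C, f k = if k ∈ A then 0 else 1) ∧ ∀ k ∉ C, 2 ≤ f k := by
    intro f
    rw [Prod.mk.injEq]
    constructor
    · rintro ⟨rfl, rfl⟩
      refine ⟨fun k => ?_, fun k => ?_, fun k => ?_⟩ <;>
        simp only [Finset.mem_filter, Finset.mem_univ, true_and] <;> grind
    · rintro ⟨h1, h2, h3⟩
      constructor <;> ext k <;> simp only [Finset.mem_filter, Finset.mem_univ, true_and]
      · by_cases hC : k ∈ C
        · simp only [h2 k hC, hC, iff_true]
          split_ifs <;> omega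
        · have := h3 k hC
          simp only [hC, iff_false]
          omega
      · exact hzero f ⟨h1, h2, h3⟩ k
  have hstat : ∀ f : Fin n → ℕ,
      (A ⊆ C ∧ (∀ k ∈ C, f k = if k ∈ A then 0 else 1) ∧ ∀ k ∉ C, 2 ≤ f k) →
      (ParkingStat i j f ↔ A.card = i ∧
        C.card - i + (if ∀ k ∈ A, ∀ l ∈ C \ A, ¬k < l then 1 else 0) = j) := by
    intro f hf
    have e0 := hzero f hf
    obtain ⟨h1, h2, h3⟩ := hf
    have e1 : ∀ k, f k = 1 ↔ k ∈ C \ A := by grind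
    have e2 : (∀ k l, k < l → ¬(f k = 0 ∧ f l = 1)) ↔ ∀ k ∈ A, ∀ l ∈ C \ A, ¬k < l := by
      simp only [e0, e1]
      exact ⟨fun h k hk l hl hkl => h k l hkl ⟨hk, hl⟩, fun h k l hkl hk => h k hk.1 l hk.2 hkl⟩
    simp only [ParkingStat, e2]
    simp only [e0, e1, Finset.filter_univ_mem, Finset.card_sdiff_of_subset h1]
    refine and_congr_right fun hA => ?_
    rw [hA]
  simp only [hfib]
  by_cases h : (A ⊆ C ∧ A.card = i) ∧
      C.card - i + (if ∀ k ∈ A, ∀ l ∈ C \ A, ¬k < l then 1 else 0) = j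
  · rw [if_pos h]
    obtain ⟨⟨hAC, hA⟩, hj⟩ := h
    have hAle := Finset.card_le_card hAC
    have hC : 2 ≤ 1 + C.card := by omega
    have := card_isShiftedParking_fibre (a := 1) (v := 2) (S := C)
      (p := fun k => if k ∈ A then 0 else 1) (fun k _ => by grind) two_pos (fun y hy => by
        have hsub : A ⊆ C.filter fun k => (if k ∈ A then 0 else 1) < 1 := fun k hk => by
          simp [hk, hAC hk]
        have := Finset.card_le_card hsub
        interval_cases y <;> omega)
    have hcard : Fintype.card {k // k ∉ C} = n - C.card := by
      rw [Fintype.card_subtype_compl]; simp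
    rw [show C.card - 1 = 1 + C.card - 2 by omega, ← hcard, ← card_isShiftedParking, ← this]
    congr 1
    refine Nat.card_congr (Equiv.subtypeEquivRight fun f => ?_)
    constructor
    · rintro ⟨⟨h1, -⟩, h2⟩
      exact ⟨h1, h2.2⟩
    · rintro ⟨h1, h2⟩
      exact ⟨⟨h1, (hstat f ⟨hAC, h2⟩).2 ⟨hA, hj⟩⟩, hAC, h2⟩
  · rw [if_neg h, Nat.cast_eq_zero, Nat.card_eq_zero]
    left
    refine ⟨fun f => h ?_⟩
    have := (hstat f.1 f.2.2).1 f.2.1.2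
    exact ⟨⟨f.2.2.1, this.1⟩, this.2⟩

open Classical in
lemma card_subsets_stat {n i j : ℕ} (hj : 1 ≤ j) (C : Finset (Fin n)) :
    ((Finset.univ.filter fun A : Finset (Fin n) => (A ⊆ C ∧ A.card = i) ∧
      C.card - i + (if ∀ k ∈ A, ∀ l ∈ C \ A, ¬k < l then 1 else 0) = j).card : ℝ) =
    (if C.card = i + j then ((i + j).choose i : ℝ) - 1 else 0) +
      if C.card = i + j - 1 then 1 else 0 := by
  have htot : (Finset.univ.filter fun A : Finset (Fin n) => A ⊆ C ∧ A.card = i).card =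
      C.card.choose i := by
    rw [← Finset.card_powersetCard]
    congr 1
    ext A
    simp [Finset.mem_powersetCard]
  have hup : i ≤ C.card → (Finset.univ.filter fun A : Finset (Fin n) =>
      (A ⊆ C ∧ A.card = i) ∧ ∀ k ∈ A, ∀ l ∈ C \ A, ¬k < l).card = 1 := fun h => by
    convert card_upper_subsets h
  by_cases h1 : C.card = i + j
  · have hsplit := Finset.card_filter_add_card_filter_not
      (s := Finset.univ.filter fun A : Finset (Fin n) => A ⊆ C ∧ A.card = i)
      (fun A => ∀ k ∈ A, ∀ l ∈ C \ A, ¬k < l)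
    rw [Finset.filter_filter, Finset.filter_filter, hup (by omega), htot, h1] at hsplit
    rw [if_pos h1, if_neg (by omega), add_zero, ← hsplit]
    push_cast
    rw [add_sub_cancel_left, Nat.cast_inj]
    congr 1
    ext A
    simp only [Finset.mem_filter, Finset.mem_univ, true_and]
    refine and_congr_right fun _ => ?_
    split_ifs with h
    · exact iff_of_false (by omega) (not_not_intro h)
    · exact iff_of_true (by omega) h
  by_cases h2 : C.card = i + j - 1
  · rw [if_neg h1, if_pos h2, zero_add, Nat.cast_eq_one]
    refine Eq.trans (congrArg Finset.card ?_) (hup (by omega))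
    ext A
    simp only [Finset.mem_filter, Finset.mem_univ, true_and]
    refine and_congr_right fun _ => ?_
    split_ifs with h
    · exact iff_of_true (by omega) h
    · exact iff_of_false (by omega) h
  · rw [if_neg h1, if_neg h2, add_zero, Nat.cast_eq_zero, Finset.card_eq_zero,
      Finset.filter_eq_empty_iff]
    rintro A - ⟨⟨hA, hAi⟩, h⟩
    have := Finset.card_le_card hA
    split_ifs at h <;> omega

theorem card_parkingStat {n i j : ℕ} (hi : 1 ≤ i) (hj : 1 ≤ j) (hn : i + j ≤ n) :
    (Nat.card {f : Fin n → ℕ // IsShiftedParking 1 f ∧ ParkingStat i j f} : ℝ) =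
      (((i + j).choose i : ℝ) - 1) * (n.choose (i + j) * parkingCount (i + j - 1) (n - (i + j))) +
        n.choose (i + j - 1) * parkingCount (i + j - 1 - 1) (n - (i + j - 1)) := by
  classical
  have : Finite {f : Fin n → ℕ // IsShiftedParking 1 f ∧ ParkingStat i j f} :=
    Finite.of_injective (β := {f : Fin n → ℕ // IsShiftedParking 1 f}) (fun f => ⟨f.1, f.2.1⟩)
      fun f g h => Subtype.ext (Subtype.mk.inj h)
  rw [card_eq_sum_fibre _ fun f : Fin n → ℕ =>
    ((Finset.univ.filter fun k => f k < 2), (Finset.univ.filter fun k => f k = 0)),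
    Nat.cast_sum, Fintype.sum_prod_type]
  simp only [card_parking_fibre hi]
  have hinner : ∀ C : Finset (Fin n), (∑ A : Finset (Fin n), if (A ⊆ C ∧ A.card = i) ∧
        C.card - i + (if ∀ k ∈ A, ∀ l ∈ C \ A, ¬k < l then 1 else 0) = j
      then parkingCount (C.card - 1) (n - C.card) else 0) =
      ((if C.card = i + j then ((i + j).choose i : ℝ) - 1 else 0) +
      if C.card = i + j - 1 then 1 else 0) * parkingCount (C.card - 1) (n - C.card) := by
    intro C
    rw [← Finset.sum_filter, Finset.sum_const, nsmul_eq_mul, card_subsets_stat hj]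
  rw [Finset.sum_congr rfl fun C _ => hinner C, ← Finset.powerset_univ,
    Finset.sum_powerset_apply_card (fun r =>
      ((if r = i + j then ((i + j).choose i : ℝ) - 1 else 0) +
      if r = i + j - 1 then 1 else 0) * parkingCount (r - 1) (n - r)), Finset.card_univ,
    Fintype.card_fin]
  simp only [nsmul_eq_mul, add_mul, mul_add, ite_mul, zero_mul, mul_ite, mul_zero,
    Finset.sum_add_distrib, one_mul]
  rw [Finset.sum_ite_eq' , Finset.sum_ite_eq', if_pos (by simp; omega), if_pos (by simp; omega)]
  ring

open Filter Topology

lemma tendsto_choose_div_pow (s : ℕ) :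
    Tendsto (fun m : ℕ => ((m + 1).choose s : ℝ) / (m : ℝ) ^ s) atTop
      (𝓝 (1 / (Nat.factorial s : ℝ))) := by
  induction s with
  | zero => simp
  | succ s ih =>
    have h1 : Tendsto (fun m : ℕ => (1 + (1 - (s : ℝ)) / m) / ((s : ℝ) + 1)) atTop
        (𝓝 ((1 + 0) / ((s : ℝ) + 1))) :=
      (tendsto_const_nhds.add (tendsto_const_div_atTop_nhds_zero_nat _)).div_const _
    have h2 := ih.mul h1
    have e : (1 / (Nat.factorial s : ℝ)) * ((1 + 0) / ((s : ℝ) + 1)) =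
        1 / (Nat.factorial (s + 1) : ℝ) := by
      rw [Nat.factorial_succ]; push_cast; field_simp; ring
    rw [e] at h2
    refine h2.congr' ?_
    filter_upwards [eventually_ge_atTop (s + 1)] with m hm
    have hm0 : (m : ℝ) ≠ 0 := by
      have : 0 < m := by omega
      positivity
    have hc : ((m + 1).choose (s + 1) : ℝ) * (s + 1) = (m + 1).choose s * (m + 1 - s) := by
      have := Nat.choose_succ_right_eq (m + 1) s
      have h3 : ((m + 1 - s : ℕ) : ℝ) = m + 1 - s := by
        rw [Nat.cast_sub (by omega)]; push_cast; ring
      rw [← h3]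
      exact_mod_cast this
    have hs : (s : ℝ) + 1 ≠ 0 := by positivity
    have hc' : ((m + 1).choose (s + 1) : ℝ) = (m + 1).choose s * (m + 1 - s) / (s + 1) := by
      rw [← hc]; field_simp
    rw [hc', pow_succ]
    field_simp
    ring

lemma tendsto_pow_ratio :
    Tendsto (fun m : ℕ => (m : ℝ) ^ m / ((m : ℝ) + 2) ^ m) atTop (𝓝 (Real.exp (-2))) := by
  have h := (Real.tendsto_one_add_div_pow_exp 2).inv₀ (Real.exp_ne_zero 2)
  rw [← Real.exp_neg] at h
  refine h.congr' ?_
  filter_upwards [eventually_ge_atTop 1] with m hm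
  have : (0 : ℝ) < m := by positivity
  rw [← div_pow, ← inv_pow]
  congr 1
  field_simp

/-- Here `m + 1` is the number of positions. -/
lemma tendsto_choose_mul_parkingCount {s : ℕ} (hs : 1 ≤ s) :
    Tendsto (fun m : ℕ => ((m + 1).choose s * parkingCount (s - 1) (m + 1 - s)) /
      ((m : ℝ) + 2) ^ m) atTop
      (𝓝 (Real.exp (-2) * (((s : ℝ) - 1) / (Nat.factorial s : ℝ)))) := by
  have h := ((tendsto_choose_div_pow s).mul tendsto_pow_ratio).const_mul ((s : ℝ) - 1)
  have e : ((s : ℝ) - 1) * (1 / (Nat.factorial s : ℝ) * Real.exp (-2)) =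
      Real.exp (-2) * (((s : ℝ) - 1) / (Nat.factorial s : ℝ)) := by ring
  rw [e] at h
  refine h.congr' ?_
  filter_upwards [eventually_ge_atTop (s + 1)] with m hm
  have hm0 : (m : ℝ) ≠ 0 := by
    have : 0 < m := by omega
    positivity
  have hsum : s - 1 + (m + 1 - s) = m := by omega
  rw [parkingCount, hsum, if_neg (by omega), Nat.cast_sub hs, Nat.cast_one]
  have hp : (m : ℝ) ^ (m + 1 - s) * (m : ℝ) ^ s = (m : ℝ) ^ m * m := by
    rw [← pow_add, ← pow_succ]
    congr 1
    omega
  have h2 : ((m : ℝ) + 2) ^ m ≠ 0 := by positivity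
  have hq : (m : ℝ) ^ (m + 1 - s) = (m : ℝ) ^ m * m / (m : ℝ) ^ s := by
    rw [← hp]; field_simp
  rw [hq]
  field_simp

end Limit

end MinFact

/-- for `i, j ≥ 1`, the proportion of minimal factorizations of size
`n` with `T_1 = i` and `T_2 = j` tends to
`e⁻² ((i+j-2)/(i+j-1)! + (i+j-1)/(i! j!) - (i+j-1)/(i+j)!)` as `n → ∞`
(the sequence is indexed by `n = m + 2`; elements `1` and `2` of `{1,…,n}` are the
indices `0` and `1` of `Fin n`). -/
theorem limit_T1_T2 (i j : ℕ) (hi : 1 ≤ i) (hj : 1 ≤ j) :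
    Filter.Tendsto (fun m : ℕ =>
      (Nat.card {F : Fin ((m + 2) - 1) → Equiv.Perm (Fin (m + 2)) //
          IsMinFact (m + 2) F ∧ Tcount F ⟨0, by omega⟩ = i ∧
            Tcount F ⟨1, by omega⟩ = j} : ℝ) /
        ((m + 2 : ℝ) ^ ((m + 2) - 2)))
      Filter.atTop
      (nhds (Real.exp (-2) *
        (((i : ℝ) + j - 2) / (Nat.factorial (i + j - 1) : ℝ) +
          ((i : ℝ) + j - 1) / ((Nat.factorial i : ℝ) * (Nat.factorial j : ℝ)) -
          ((i : ℝ) + j - 1) / (Nat.factorial (i + j) : ℝ)))) := by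
  have hpos : 1 ≤ i + j - 1 := by omega
  have hc : (((i + j - 1 : ℕ) : ℝ)) = (i : ℝ) + j - 1 := by
    rw [Nat.cast_sub (by omega)]
    push_cast
    ring
  have h := ((MinFact.tendsto_choose_mul_parkingCount (s := i + j) (by omega)).const_mul
    (((i + j).choose i : ℝ) - 1)).add (MinFact.tendsto_choose_mul_parkingCount hpos)
  have hchoose : ((i + j).choose i : ℝ) =
      (Nat.factorial (i + j) : ℝ) / ((Nat.factorial i : ℝ) * (Nat.factorial j : ℝ)) := by
    rw [Nat.cast_add_choose]
  have e : (((i + j).choose i : ℝ) - 1) * (Real.exp (-2) *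
        ((((i + j : ℕ) : ℝ) - 1) / (Nat.factorial (i + j) : ℝ))) + Real.exp (-2) *
        ((((i + j - 1 : ℕ) : ℝ) - 1) / (Nat.factorial (i + j - 1) : ℝ)) =
      Real.exp (-2) *
        (((i : ℝ) + j - 2) / (Nat.factorial (i + j - 1) : ℝ) +
          ((i : ℝ) + j - 1) / ((Nat.factorial i : ℝ) * (Nat.factorial j : ℝ)) -
          ((i : ℝ) + j - 1) / (Nat.factorial (i + j) : ℝ)) := by
    rw [hc, hchoose]
    push_cast
    field_simp
    ring
  rw [e] at h
  refine h.congr' ?_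
  filter_upwards [Filter.eventually_ge_atTop (i + j)] with m hm
  have h1 := MinFact.card_parkingStat (n := m + 1) hi hj (by omega)
  rw [← MinFact.card_minFact_eq] at h1
  refine Eq.trans ?_ (congrArg (fun x : ℝ => x / ((m : ℝ) + 2) ^ m) h1.symm)
  ring
end
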